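/- arXiv:math/0202001 — 4 statements merged into one kernel-verified Lean document; each statement's English description precedes it below -/
import Mathlib

section
/- Let F be the set of all homeomorphisms f of the interval [0,1] that are piecewise linear with finitely many breakpoints, all breakpoints lying at dyadic rational points m/2^n, and with the slope of every linear piece an integer power of 2. Then F is a group under composition (Thompson's group F); the abelianization F/[F,F] is isomorphic to ℤ × ℤ; the commutator subgroup [F,F] is simple; F contains no subgroup isomorphic to the free group of rank 2; and F satisfies no group law, i.e. for every non-trivial reduced word w(x₁,…,x_n) in a free group of finite rank there exist f₁,…,f_n ∈ F with w(f₁,…,f_n) ≠ id. -/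
/-- A real number is dyadic rational if it has the form `m / 2^n`. -/
def IsDyadic (x : ℝ) : Prop := ∃ (m : ℤ) (n : ℕ), x = (m : ℝ) / 2 ^ n

/-- An element of Thompson's group `F`: a homeomorphism of `[0,1]` which is piecewise
linear with finitely many breakpoints, all breakpoints dyadic rationals, and all slopes
integer powers of `2`. -/
def IsThompsonF (f : Equiv.Perm ↥(Set.Icc (0 : ℝ) 1)) : Prop :=
  Continuous f ∧
  ∃ (k : ℕ) (t : Fin (k + 1) → ℝ),
    t 0 = 0 ∧ t (Fin.last k) = 1 ∧ StrictMono t ∧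
    (∀ i, IsDyadic (t i)) ∧
    ∀ i : Fin k, ∃ (p : ℤ) (c : ℝ), ∀ x : ↥(Set.Icc (0 : ℝ) 1),
      t i.castSucc ≤ (x : ℝ) → (x : ℝ) ≤ t i.succ →
        ((f x : ℝ)) = (2 : ℝ) ^ p * (x : ℝ) + c

open Set
open scoped commutatorElement

namespace IsDyadic

theorem natCast (m : ℕ) : IsDyadic m := ⟨m, 0, by simp⟩

theorem zero : IsDyadic 0 := ⟨0, 0, by simp⟩

theorem one : IsDyadic 1 := ⟨1, 0, by simp⟩

theorem add {x y : ℝ} (hx : IsDyadic x) (hy : IsDyadic y) : IsDyadic (x + y) := by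
  obtain ⟨m, n, rfl⟩ := hx
  obtain ⟨m', n', rfl⟩ := hy
  refine ⟨m * 2 ^ n' + m' * 2 ^ n, n + n', ?_⟩
  push_cast
  field_simp
  ring

theorem neg {x : ℝ} (hx : IsDyadic x) : IsDyadic (-x) := by
  obtain ⟨m, n, rfl⟩ := hx
  exact ⟨-m, n, by push_cast; ring⟩

theorem sub {x y : ℝ} (hx : IsDyadic x) (hy : IsDyadic y) : IsDyadic (x - y) := by
  simpa [sub_eq_add_neg] using hx.add hy.neg

theorem mul {x y : ℝ} (hx : IsDyadic x) (hy : IsDyadic y) : IsDyadic (x * y) := by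
  obtain ⟨m, n, rfl⟩ := hx
  obtain ⟨m', n', rfl⟩ := hy
  refine ⟨m * m', n + n', ?_⟩
  push_cast
  field_simp
  ring

theorem two_zpow (p : ℤ) : IsDyadic ((2 : ℝ) ^ p) := by
  obtain ⟨n, rfl | rfl⟩ := p.eq_nat_or_neg
  · exact ⟨2 ^ n, 0, by simp⟩
  · exact ⟨1, n, by simp⟩

theorem exists_two_zpow_lt {x : ℝ} (hx : 0 < x) : ∃ p : ℤ, (2 : ℝ) ^ p < x := by
  obtain ⟨n, hn⟩ := exists_pow_lt_of_lt_one hx (by norm_num : (1 / 2 : ℝ) < 1)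
  exact ⟨-n, by simpa using hn⟩

theorem exists_between {a b : ℝ} (h : a < b) : ∃ c, IsDyadic c ∧ a < c ∧ c < b := by
  obtain ⟨n, hn⟩ := exists_pow_lt_of_lt_one (sub_pos.2 h) (by norm_num : (1 / 2 : ℝ) < 1)
  have h2 : (0 : ℝ) < 2 ^ n := by positivity
  rw [one_div, inv_pow, inv_lt_iff_one_lt_mul₀ h2] at hn
  refine ⟨(⌊a * 2 ^ n⌋ + 1 : ℤ) / 2 ^ n, ⟨_, n, rfl⟩, ?_, ?_⟩
  · rw [lt_div_iff₀ h2]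
    push_cast
    exact Int.lt_floor_add_one _
  · rw [div_lt_iff₀ h2]
    push_cast
    have := Int.floor_le (a * 2 ^ n)
    nlinarith

theorem exists_common_denominator (S : Finset ℝ) (hS : ∀ s ∈ S, IsDyadic s) :
    ∃ k : ℕ, ∀ s ∈ S, ∃ m : ℤ, 2 ^ k * s = m := by
  induction S using Finset.induction_on with
  | empty => exact ⟨0, by simp⟩
  | insert a S _ ih =>
    obtain ⟨k, hk⟩ := ih fun s hs => hS s (Finset.mem_insert_of_mem hs)
    obtain ⟨m, n, hm⟩ := hS a (Finset.mem_insert_self a S)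
    refine ⟨k + n, fun s hs => ?_⟩
    rcases Finset.mem_insert.1 hs with rfl | hs
    · refine ⟨2 ^ k * m, ?_⟩
      rw [hm]
      push_cast
      field_simp
      ring
    · obtain ⟨l, hl⟩ := hk s hs
      refine ⟨2 ^ n * l, ?_⟩
      push_cast
      rw [← hl]
      ring

end IsDyadic

theorem Finset.exists_gt_forall_notMem_Ioo (S : Finset ℝ) (x : ℝ) :
    ∃ b > x, ∀ s ∈ S, s ∉ Set.Ioo x b := by
  induction S using Finset.induction_on with
  | empty => exact ⟨x + 1, by simp⟩
  | insert a S _ ih =>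
    obtain ⟨b, hb, h⟩ := ih
    by_cases ha : x < a
    · refine ⟨min a b, lt_min ha hb, fun s hs hs' => ?_⟩
      rcases Finset.mem_insert.1 hs with rfl | hs
      · exact (hs'.2.trans_le (min_le_left _ _)).false
      · exact h s hs ⟨hs'.1, hs'.2.trans_le (min_le_right _ _)⟩
    · refine ⟨b, hb, fun s hs hs' => ?_⟩
      rcases Finset.mem_insert.1 hs with rfl | hs
      · exact ha hs'.1
      · exact h s hs hs'

theorem Finset.exists_lt_forall_notMem_Ioo (S : Finset ℝ) (x : ℝ) :
    ∃ b < x, ∀ s ∈ S, s ∉ Set.Ioo b x := by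
  obtain ⟨b, hb, h⟩ := (S.image Neg.neg).exists_gt_forall_notMem_Ioo (-x)
  refine ⟨-b, by linarith, fun s hs hs' => h (-s) (Finset.mem_image_of_mem _ hs) ?_⟩
  exact ⟨by linarith [hs'.2], by linarith [hs'.1]⟩

/-- An increasing homeomorphism of the line is dyadic piecewise linear if away from finitely many
dyadic points it is of the form `x ↦ 2 ^ p * x + c` with `p` an integer and `c` dyadic. -/
def IsDyadicPLWith (S : Finset ℝ) (f : ℝ ≃o ℝ) : Prop :=
  (∀ s ∈ S, IsDyadic s) ∧ ∀ a b : ℝ, a < b → (∀ s ∈ S, s ∉ Ioo a b) →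
    ∃ (p : ℤ) (c : ℝ), IsDyadic c ∧ ∀ x ∈ Icc a b, f x = 2 ^ p * x + c

namespace IsDyadicPLWith

variable {S T : Finset ℝ} {f g : ℝ ≃o ℝ}

theorem isDyadic_apply (hf : IsDyadicPLWith S f) {x : ℝ} (hx : IsDyadic x) : IsDyadic (f x) := by
  obtain ⟨b, hb, h⟩ := S.exists_gt_forall_notMem_Ioo x
  obtain ⟨p, c, hc, hf⟩ := hf.2 x b hb h
  rw [hf x ⟨le_rfl, hb.le⟩]
  exact ((IsDyadic.two_zpow p).mul hx).add hc

theorem isDyadic_inv_apply (hf : IsDyadicPLWith S f) {x : ℝ} (hx : IsDyadic x) :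
    IsDyadic (f⁻¹ x) := by
  obtain ⟨b, hb, h⟩ := S.exists_gt_forall_notMem_Ioo (f⁻¹ x)
  obtain ⟨p, c, hc, hf⟩ := hf.2 _ b hb h
  have h1 := hf _ ⟨le_rfl, hb.le⟩
  rw [RelIso.apply_inv_self] at h1
  have h2 : f⁻¹ x = 2 ^ (-p) * (x - c) := by
    rw [zpow_neg]
    field_simp
    linarith
  rw [h2]
  exact (IsDyadic.two_zpow _).mul (hx.sub hc)

theorem one : IsDyadicPLWith ∅ 1 :=
  ⟨by simp, fun a b _ _ => ⟨0, 0, IsDyadic.zero, by simp⟩⟩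

theorem mul (hf : IsDyadicPLWith S f) (hg : IsDyadicPLWith T g) :
    IsDyadicPLWith (T ∪ S.image ⇑g⁻¹) (f * g) := by
  refine ⟨fun s hs => ?_, fun a b hab h => ?_⟩
  · rcases Finset.mem_union.1 hs with hs | hs
    · exact hg.1 s hs
    · obtain ⟨t, ht, rfl⟩ := Finset.mem_image.1 hs
      exact hg.isDyadic_inv_apply (hf.1 t ht)
  · obtain ⟨p, c, hc, h1⟩ := hg.2 a b hab fun s hs => h s (Finset.mem_union_left _ hs)
    obtain ⟨q, d, hd, h2⟩ := hf.2 (g a) (g b) (g.lt_iff_lt.2 hab) fun s hs hs' => by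
      refine h (g⁻¹ s) (Finset.mem_union_right _ (Finset.mem_image_of_mem _ hs)) ⟨?_, ?_⟩
      · rw [← g.lt_iff_lt, RelIso.apply_inv_self]; exact hs'.1
      · rw [← g.lt_iff_lt, RelIso.apply_inv_self]; exact hs'.2
    refine ⟨q + p, 2 ^ q * c + d, ((IsDyadic.two_zpow q).mul hc).add hd, fun x hx => ?_⟩
    rw [RelIso.mul_apply, h2 _ ⟨g.le_iff_le.2 hx.1, g.le_iff_le.2 hx.2⟩, h1 x hx,
      zpow_add₀ two_ne_zero]
    ring

theorem inv (hf : IsDyadicPLWith S f) : IsDyadicPLWith (S.image f) f⁻¹ := by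
  refine ⟨fun s hs => ?_, fun a b hab h => ?_⟩
  · obtain ⟨t, ht, rfl⟩ := Finset.mem_image.1 hs
    exact hf.isDyadic_apply (hf.1 t ht)
  · have key : ∀ x y, f⁻¹ x < y ↔ x < f y := fun x y => by
      rw [← f.lt_iff_lt, RelIso.apply_inv_self]
    have key' : ∀ x y, y < f⁻¹ x ↔ f y < x := fun x y => by
      rw [← f.lt_iff_lt, RelIso.apply_inv_self]
    obtain ⟨p, c, hc, h1⟩ := hf.2 (f⁻¹ a) (f⁻¹ b) ((key _ _).2 (by simpa)) fun s hs hs' =>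
      h (f s) (Finset.mem_image_of_mem _ hs) ⟨(key _ _).1 hs'.1, (key' _ _).1 hs'.2⟩
    refine ⟨-p, -(2 ^ (-p) * c), ((IsDyadic.two_zpow _).mul hc).neg, fun x hx => ?_⟩
    have h2 := h1 (f⁻¹ x) ⟨(OrderIso.le_iff_le f⁻¹).2 hx.1, (OrderIso.le_iff_le f⁻¹).2 hx.2⟩
    rw [RelIso.apply_inv_self] at h2
    rw [zpow_neg]
    field_simp
    linarith

end IsDyadicPLWith

/-- The group of dyadic piecewise linear homeomorphisms of the line. -/
def dyadicPL : Subgroup (ℝ ≃o ℝ) where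
  carrier := {f | ∃ S, IsDyadicPLWith S f}
  one_mem' := ⟨_, .one⟩
  mul_mem' := fun ⟨_, hf⟩ ⟨_, hg⟩ => ⟨_, hf.mul hg⟩
  inv_mem' := fun ⟨_, hf⟩ => ⟨_, hf.inv⟩

/-- The affine map `x ↦ 2 ^ p * x + c`. -/
noncomputable def dyadicAffine (p : ℤ) (c : ℝ) : ℝ ≃o ℝ :=
  (OrderIso.mulLeft₀ ((2 : ℝ) ^ p) (by positivity)).trans (OrderIso.addRight c)

@[simp] theorem dyadicAffine_apply (p : ℤ) (c x : ℝ) : dyadicAffine p c x = 2 ^ p * x + c := rfl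

theorem dyadicAffine_mem (p : ℤ) {c : ℝ} (hc : IsDyadic c) : dyadicAffine p c ∈ dyadicPL :=
  ⟨∅, by simp, fun _ _ _ _ => ⟨p, c, hc, fun _ _ => rfl⟩⟩

/-- The homeomorphism that agrees with `f` to the left of `e` and with `g` to the right of `e`. -/
theorem OrderIso.exists_glue (f g : ℝ ≃o ℝ) {e : ℝ} (h : f e = g e) :
    ∃ k : ℝ ≃o ℝ, (∀ x ≤ e, k x = f x) ∧ ∀ x, e ≤ x → k x = g x := by
  classical
  have hk : StrictMono fun x => if x ≤ e then f x else g x := by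
    intro x y hxy
    dsimp only
    split_ifs with h1 h2 h2
    · exact f.lt_iff_lt.2 hxy
    · exact ((f.le_iff_le.2 h1).trans_eq h).trans_lt (g.lt_iff_lt.2 (not_le.1 h2))
    · exact absurd (hxy.le.trans h2) h1
    · exact g.lt_iff_lt.2 hxy
  have hs : Function.Surjective fun x => if x ≤ e then f x else g x := by
    intro y
    rcases le_or_gt y (f e) with hy | hy
    · refine ⟨f.symm y, ?_⟩
      dsimp only
      rw [if_pos (by rwa [f.symm_apply_le]), f.apply_symm_apply]
    · refine ⟨g.symm y, ?_⟩
      dsimp only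
      rw [if_neg (by rw [g.symm_apply_le, not_le, ← h]; exact hy), g.apply_symm_apply]
  refine ⟨hk.orderIsoOfSurjective _ hs, fun x hx => ?_, fun x hx => ?_⟩
  · simp [hx]
  · rcases hx.eq_or_lt with rfl | hx
    · simp [h]
    · simp [not_le.2 hx]

theorem exists_dyadicPL_glue {f g : ℝ ≃o ℝ} (hf : f ∈ dyadicPL) (hg : g ∈ dyadicPL) {e : ℝ}
    (he : IsDyadic e) (h : f e = g e) :
    ∃ k ∈ dyadicPL, (∀ x ≤ e, k x = f x) ∧ ∀ x, e ≤ x → k x = g x := by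
  obtain ⟨k, h1, h2⟩ := OrderIso.exists_glue f g h
  obtain ⟨S, hS⟩ := hf
  obtain ⟨T, hT⟩ := hg
  refine ⟨k, ⟨insert e (S ∪ T), ?_, fun a b hab hs => ?_⟩, h1, h2⟩
  · simp only [Finset.mem_insert, Finset.mem_union]
    rintro s (rfl | hs | hs)
    exacts [he, hS.1 s hs, hT.1 s hs]
  · rcases le_or_gt b e with hb | hb
    · obtain ⟨p, c, hc, hp⟩ := hS.2 a b hab fun s hs' => hs s (by simp [hs'])
      exact ⟨p, c, hc, fun x hx => by rw [h1 x (hx.2.trans hb), hp x hx]⟩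
    · have ha : e ≤ a := not_lt.1 fun ha => hs e (by simp) ⟨ha, hb⟩
      obtain ⟨p, c, hc, hp⟩ := hT.2 a b hab fun s hs' => hs s (by simp [hs'])
      exact ⟨p, c, hc, fun x hx => by rw [h2 x (ha.trans hx.1), hp x hx]⟩

/-- The dyadic piecewise linear homeomorphisms that are the identity outside `[a, b]`. -/
def dyadicPLOn (a b : ℝ) : Subgroup (ℝ ≃o ℝ) where
  carrier := {f | f ∈ dyadicPL ∧ ∀ x, x ≤ a ∨ b ≤ x → f x = x}
  one_mem' := ⟨one_mem _, fun _ _ => rfl⟩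
  mul_mem' := fun ⟨hf, hf'⟩ ⟨hg, hg'⟩ =>
    ⟨mul_mem hf hg, fun x hx => by rw [RelIso.mul_apply, hg' x hx, hf' x hx]⟩
  inv_mem' := fun {f} ⟨hf, hf'⟩ => ⟨inv_mem hf, fun x hx => by
    rw [← f.injective.eq_iff, RelIso.apply_inv_self, hf' x hx]⟩

theorem dyadicPLOn_mono {a b a' b' : ℝ} (ha : a' ≤ a) (hb : b ≤ b') :
    dyadicPLOn a b ≤ dyadicPLOn a' b' := fun _ hf =>
  ⟨hf.1, fun x hx => hf.2 x (hx.imp (fun h => h.trans ha) fun h => hb.trans h)⟩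

theorem conj_mem_dyadicPLOn {a b : ℝ} {f g : ℝ ≃o ℝ} (hf : f ∈ dyadicPLOn a b)
    (hg : g ∈ dyadicPL) : g * f * g⁻¹ ∈ dyadicPLOn (g a) (g b) := by
  refine ⟨mul_mem (mul_mem hg hf.1) (inv_mem hg), fun x hx => ?_⟩
  obtain ⟨y, rfl⟩ := g.surjective x
  rw [g.le_iff_le, g.le_iff_le] at hx
  simp only [RelIso.mul_apply, RelIso.inv_apply_self, hf.2 y hx]

/-- A homeomorphism supported in `[a, b]` that moves the points of `(a, b)` to the right, with
slope `2` at `a`, slope `1 / 2` at `b`, and equal to a translation in between. -/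
theorem exists_dyadicPL_bump {a b : ℝ} {p : ℤ} (ha : IsDyadic a) (hb : IsDyadic b)
    (h : a + 3 * 2 ^ p ≤ b) :
    ∃ f ∈ dyadicPLOn a b, (∀ x ∈ Icc a (a + 2 ^ p), f x = 2 * x - a) ∧
      (∀ x ∈ Icc (a + 2 ^ p) (b - 2 * 2 ^ p), f x = x + 2 ^ p) ∧
      ∀ x ∈ Icc (b - 2 * 2 ^ p) b, f x = (x + b) / 2 := by
  have hw : (0 : ℝ) < 2 ^ p := by positivity
  have hd := IsDyadic.two_zpow p
  have hd2 : IsDyadic 2 := by simpa using IsDyadic.natCast 2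
  have hbh : IsDyadic (b / 2) := by simpa [div_eq_inv_mul] using (IsDyadic.two_zpow (-1)).mul hb
  obtain ⟨f₁, hf₁, h1, h1'⟩ := exists_dyadicPL_glue (one_mem _)
    (dyadicAffine_mem 1 ha.neg) ha (by simp; ring)
  obtain ⟨f₂, hf₂, h2, h2'⟩ := exists_dyadicPL_glue hf₁
    (dyadicAffine_mem 0 hd) (ha.add hd) (by rw [h1' _ (by linarith)]; simp; ring)
  obtain ⟨f₃, hf₃, h3, h3'⟩ := exists_dyadicPL_glue hf₂
    (dyadicAffine_mem (-1) hbh) (hb.sub (hd2.mul hd)) (by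
      rw [h2' _ (by linarith)]; simp; ring)
  obtain ⟨f₄, hf₄, h4, h4'⟩ := exists_dyadicPL_glue hf₃ (one_mem _) hb (by
      rw [h3' _ (by linarith)]; simp; ring)
  refine ⟨f₄, ⟨hf₄, fun x hx => ?_⟩, fun x hx => ?_, fun x hx => ?_, fun x hx => ?_⟩
  · rcases hx with hx | hx
    · rw [h4 x (by linarith), h3 x (by linarith), h2 x (by linarith), h1 x hx]; rfl
    · rw [h4' x hx]; rfl
  · rw [h4 x (by linarith [hx.2]), h3 x (by linarith [hx.2]), h2 x hx.2, h1' x hx.1]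
    simp; ring
  · rw [h4 x (by linarith [hx.2]), h3 x hx.2, h2' x hx.1]
    simp
  · rw [h4 x hx.2, h3' x hx.1]
    simp; ring

theorem exists_dyadicPL_lt_apply {a b : ℝ} (ha : IsDyadic a) (hb : IsDyadic b) (h : a < b) :
    ∃ f ∈ dyadicPLOn a b, ∀ x ∈ Ioo a b, x < f x := by
  obtain ⟨p, hp⟩ := IsDyadic.exists_two_zpow_lt (x := (b - a) / 3) (by linarith)
  have hw : (0 : ℝ) < 2 ^ p := by positivity
  obtain ⟨f, hf, h1, h2, h3⟩ := exists_dyadicPL_bump (p := p) ha hb (by linarith)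
  refine ⟨f, hf, fun x hx => ?_⟩
  rcases le_total x (a + 2 ^ p) with hx1 | hx1
  · rw [h1 x ⟨hx.1.le, hx1⟩]; linarith [hx.1]
  rcases le_total x (b - 2 * 2 ^ p) with hx2 | hx2
  · rw [h2 x ⟨hx1, hx2⟩]; linarith
  · rw [h3 x ⟨hx2, hx.2.le⟩]; linarith [hx.2]

/-- If `f` moves every point of `[a, b]` to the right, then some power of `f` moves `a` past
`b`. -/
theorem OrderIso.exists_lt_pow_apply (f : ℝ ≃o ℝ) {a b : ℝ} (h : ∀ x ∈ Icc a b, x < f x) :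
    ∃ n : ℕ, b < (f ^ n) a := by
  by_contra! hn
  have ha : ∀ n : ℕ, (f ^ (n + 1)) a = f ((f ^ n) a) := fun n => by
    rw [pow_succ', RelIso.mul_apply]
  have hge : ∀ n : ℕ, a ≤ (f ^ n) a := fun n => by
    induction n with
    | zero => simp
    | succ n ih => rw [ha]; exact ih.trans (h _ ⟨ih, hn n⟩).le
  have hb : BddAbove (range fun n : ℕ => (f ^ n) a) := ⟨b, by rintro _ ⟨n, rfl⟩; exact hn n⟩
  set s := ⨆ n : ℕ, (f ^ n) a
  have hs : a ≤ s := (hge 0).trans (le_ciSup hb 0)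
  have hs' : s ≤ b := ciSup_le hn
  have h1 : f.symm s < s := by
    rw [f.symm_apply_lt]; exact h s ⟨hs, hs'⟩
  obtain ⟨n, hn⟩ := exists_lt_of_lt_ciSup h1
  rw [f.symm_apply_lt, ← ha] at hn
  exact (hn.trans_le (le_ciSup hb (n + 1))).false

theorem pow_translation_apply {τ : ℝ ≃o ℝ} {M : ℕ} (hτ : ∀ x ∈ Icc (0 : ℝ) M, τ x = x + 1) (n : ℕ)
    {x : ℝ} (hx : 0 ≤ x) (hxn : x + n ≤ M + 1) : (τ ^ n) x = x + n := by
  induction n with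
  | zero => simp
  | succ n ih =>
    push_cast at hxn
    rw [pow_succ', RelIso.mul_apply, ih (by linarith), hτ _ ⟨by positivity, by linarith⟩]
    push_cast
    ring

/-- `g` is the identity up to `j`, doubles `[j, j + 1]` and then coincides with `τ`. -/
structure IsDoublingAt (τ : ℝ ≃o ℝ) (j : ℕ) (g : ℝ ≃o ℝ) : Prop where
  left : ∀ x ≤ (j : ℝ), g x = x
  mid : ∀ x ∈ Icc (j : ℝ) (j + 1), g x = 2 * x - j
  right : ∀ x, (j : ℝ) + 1 ≤ x → g x = τ x

/-- `g` is the identity on the negative half-line, coincides with `τ ^ n` beyond `N`, and is affine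
with slope a nonnegative power of `2` on each `[j, j + 1]` with `j < N`. -/
structure IsExpanding (τ : ℝ ≃o ℝ) (N n : ℕ) (g : ℝ ≃o ℝ) : Prop where
  left : ∀ x ≤ (0 : ℝ), g x = x
  mid : ∀ j : ℕ, j < N → ∃ p : ℕ, ∀ x ∈ Icc (j : ℝ) (j + 1), g x = 2 ^ p * (x - j) + g j
  right : ∀ x, (N : ℝ) ≤ x → g x = (τ ^ n) x

theorem exists_isDoublingAt {M : ℕ} {τ : ℝ ≃o ℝ} (hτK : τ ∈ dyadicPLOn (-1) (M + 2))
    (hτ : ∀ x ∈ Icc (0 : ℝ) M, τ x = x + 1) {j : ℕ} (hj : j + 1 ≤ M) :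
    ∃ g ∈ dyadicPLOn (-1) (M + 2), IsDoublingAt τ j g := by
  have hj' : (j : ℝ) + 1 ≤ M := by exact_mod_cast hj
  have hj0 : (0 : ℝ) ≤ j := j.cast_nonneg
  obtain ⟨f₁, hf₁, h1, h1'⟩ := exists_dyadicPL_glue (one_mem _)
    (dyadicAffine_mem 1 (IsDyadic.natCast j).neg) (IsDyadic.natCast j) (by simp; ring)
  obtain ⟨f₂, hf₂, h2, h2'⟩ := exists_dyadicPL_glue hf₁ hτK.1
    ((IsDyadic.natCast j).add IsDyadic.one) (by
      rw [h1' _ (by linarith), hτ _ ⟨by linarith, hj'⟩]; simp; ring)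
  have hl : ∀ x ≤ (j : ℝ), f₂ x = x := fun x hx => by rw [h2 x (by linarith), h1 x hx]; rfl
  refine ⟨f₂, ⟨hf₂, fun x hx => ?_⟩, hl, fun x hx => ?_, h2'⟩
  · rcases hx with hx | hx
    · exact hl x (by linarith)
    · rw [h2' x (by linarith), hτK.2 x (Or.inr hx)]
  · rw [h2 x hx.2, h1' x hx.1]
    simp; ring

theorem IsDoublingAt.mul_eq {M : ℕ} {τ f g : ℝ ≃o ℝ} (hτ : ∀ x ∈ Icc (0 : ℝ) M, τ x = x + 1)
    {j : ℕ} (hj : j + 2 ≤ M) (hf : IsDoublingAt τ j f) (hg : IsDoublingAt τ (j + 1) g) :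
    τ * f = g * τ := by
  have hj' : (j : ℝ) + 2 ≤ M := by exact_mod_cast hj
  have hj0 : (0 : ℝ) ≤ j := j.cast_nonneg
  have hg1 := hg.left
  have hg2 := hg.mid
  have hg3 := hg.right
  push_cast at hg1 hg2 hg3
  have hτj : τ j = j + 1 := hτ j ⟨hj0, by linarith⟩
  ext x
  rw [RelIso.mul_apply, RelIso.mul_apply]
  rcases le_total x j with h1 | h1
  · rw [hf.left x h1, hg1 _ (by rwa [← hτj, τ.le_iff_le])]
  rcases le_total x (j + 1) with h2 | h2
  · rw [hf.mid x ⟨h1, h2⟩, hτ x ⟨by linarith, by linarith⟩, hg2 _ ⟨by linarith, by linarith⟩]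
    rw [hτ _ ⟨by linarith, by linarith⟩]
    ring
  · rw [hf.right x h2, hg3]
    have := τ.le_iff_le.2 h2
    rw [hτ (j + 1) ⟨by linarith, by linarith⟩] at this
    exact this

theorem IsExpanding.mul_inv {M N n j p : ℕ} {τ g d : ℝ ≃o ℝ}
    (hτ : ∀ x ∈ Icc (0 : ℝ) M, τ x = x + 1) (hN : N ≤ M)
    (hg : IsExpanding τ N (n + 1) g) (hj : j < N)
    (hp : ∀ x ∈ Icc (j : ℝ) (j + 1), g x = 2 ^ (p + 1) * (x - j) + g j)
    (hd : IsDoublingAt τ j d) : IsExpanding τ (N + 1) n (g * d⁻¹) := by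
  have hNM : (N : ℝ) ≤ M := by exact_mod_cast hN
  have hj0 : (0 : ℝ) ≤ j := j.cast_nonneg
  have hjN : (j : ℝ) + 1 ≤ N := by exact_mod_cast hj
  have key : ∀ {x y}, d x = y → (g * d⁻¹) y = g x := by
    rintro x _ rfl
    rw [RelIso.mul_apply, RelIso.inv_apply_self]
  have hl : ∀ x ≤ (j : ℝ), (g * d⁻¹) x = g x := fun x hx => key (hd.left x hx)
  have hm : ∀ x ∈ Icc (j : ℝ) (j + 2), (g * d⁻¹) x = 2 ^ p * (x - j) + g j := fun x hx => by
    have h1 : (x + j) / 2 ∈ Icc (j : ℝ) (j + 1) := ⟨by linarith [hx.1], by linarith [hx.2]⟩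
    rw [key (x := (x + j) / 2) (by rw [hd.mid _ h1]; ring), hp _ h1]
    ring
  have hr : ∀ x, (j : ℝ) + 2 ≤ x → x ≤ N + 1 → (g * d⁻¹) x = g (x - 1) := fun x h1 h2 => by
    refine key ?_
    rw [hd.right _ (by linarith), hτ _ ⟨by linarith, by linarith⟩]
    ring
  refine ⟨fun x hx => ?_, fun i hi => ?_, fun x hx => ?_⟩
  · rw [hl x (by linarith), hg.left x hx]
  · rcases lt_or_ge i j with h | h
    · obtain ⟨q, hq⟩ := hg.mid i (by omega)
      have h' : (i : ℝ) + 1 ≤ j := by exact_mod_cast h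
      refine ⟨q, fun x hx => ?_⟩
      rw [hl x (hx.2.trans h'), hl i (by linarith), hq x hx]
    rcases lt_or_ge i (j + 2) with h2 | h2
    · have h' : (j : ℝ) ≤ i := by exact_mod_cast h
      have h2' : (i : ℝ) + 1 ≤ j + 2 := by exact_mod_cast h2
      refine ⟨p, fun x hx => ?_⟩
      rw [hm x ⟨h'.trans hx.1, hx.2.trans h2'⟩, hm i ⟨h', by linarith⟩]
      ring
    · obtain ⟨i, rfl⟩ : ∃ k, i = k + 1 := ⟨i - 1, by omega⟩
      obtain ⟨q, hq⟩ := hg.mid i (by omega)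
      have h' : (i : ℝ) + 1 ≤ N := by exact_mod_cast (by omega : i + 1 ≤ N)
      have h2' : (j : ℝ) + 2 ≤ i + 1 := by exact_mod_cast h2
      refine ⟨q, fun x hx => ?_⟩
      push_cast at hx ⊢
      rw [hr x (h2'.trans hx.1) (by linarith [hx.2]), hr _ h2' (by linarith),
        hq _ ⟨by linarith [hx.1], by linarith [hx.2]⟩]
      ring_nf
  · push_cast at hx
    have h1 : (N : ℝ) ≤ τ⁻¹ x := by
      rw [← τ.le_iff_le, RelIso.apply_inv_self, hτ _ ⟨by positivity, hNM⟩]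
      exact hx
    rw [key (x := τ⁻¹ x) (by rw [hd.right _ (hjN.trans h1), RelIso.apply_inv_self]),
      hg.right _ h1, pow_succ, RelIso.mul_apply, RelIso.apply_inv_self]

theorem IsExpanding.eq_one_or_exists {M N n : ℕ} {τ g : ℝ ≃o ℝ}
    (hτ : ∀ x ∈ Icc (0 : ℝ) M, τ x = x + 1) (hM : N + n = M) (hg : IsExpanding τ N n g) :
    (n = 0 ∧ g = 1) ∨ 0 < n ∧ ∃ j < N, ∃ p : ℕ,
      ∀ x ∈ Icc (j : ℝ) (j + 1), g x = 2 ^ (p + 1) * (x - j) + g j := by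
  have hgN : g N = N + n := by
    rw [hg.right N le_rfl, pow_translation_apply hτ n (by positivity)]
    rw [← hM]; push_cast; linarith
  by_cases h : ∃ j < N, ∃ p : ℕ, ∀ x ∈ Icc (j : ℝ) (j + 1), g x = 2 ^ (p + 1) * (x - j) + g j
  · refine Or.inr ⟨Nat.pos_of_ne_zero ?_, h⟩
    rintro rfl
    obtain ⟨j, hj, p, hp⟩ := h
    have hstep : ∀ i : ℕ, i < N → g i + 1 ≤ g (i + 1) := fun i hi => by
      obtain ⟨q, hq⟩ := hg.mid i hi
      rw [hq _ ⟨by linarith, le_rfl⟩]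
      have : (1 : ℝ) ≤ 2 ^ q := one_le_pow₀ (by norm_num)
      linarith
    have h1 : ∀ i : ℕ, i ≤ N → (i : ℝ) ≤ g i := fun i hi => by
      induction i with
      | zero => simp [hg.left]
      | succ i ih =>
        push_cast
        linarith [ih (by omega), hstep i hi]
    have h2 : ∀ i : ℕ, j + 1 + i ≤ N → (j + 1 + i : ℝ) + 1 ≤ g (j + 1 + i) := fun i hi => by
      induction i with
      | zero =>
        have h3 := hp (j + 1) ⟨by linarith, le_rfl⟩
        have h4 : (1 : ℝ) ≤ 2 ^ p := one_le_pow₀ (by norm_num)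
        simp only [Nat.cast_zero, add_zero]
        rw [h3, pow_succ]
        linarith [h1 j hj.le]
      | succ i ih =>
        have := hstep (j + 1 + i) (by omega)
        push_cast at this ⊢
        rw [← add_assoc]
        linarith [ih (by omega)]
    have h3 := h2 (N - (j + 1)) (by omega)
    rw [Nat.cast_sub hj] at h3
    push_cast at h3 hgN
    rw [add_sub_cancel, hgN] at h3
    linarith
  · push Not at h
    have h1 : ∀ j : ℕ, j < N → ∀ x ∈ Icc (j : ℝ) (j + 1), g x = x - j + g j := fun j hj => by
      obtain ⟨p, hp⟩ := hg.mid j hj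
      rcases p with _ | p
      · simpa using hp
      · obtain ⟨x, hx, hne⟩ := h j hj p
        exact absurd (hp x hx) hne
    have h2 : ∀ j : ℕ, j ≤ N → ∀ x ≤ (j : ℝ), g x = x := fun j hj => by
      induction j with
      | zero => simpa using hg.left
      | succ j ih =>
        intro x hx
        push_cast at hx
        rcases le_total x j with hxj | hxj
        · exact ih (by omega) x hxj
        · rw [h1 j hj x ⟨hxj, hx⟩, ih (by omega) j le_rfl]
          ring
    have hn : n = 0 := by
      have := h2 N le_rfl N le_rfl
      rw [hgN] at this
      exact_mod_cast (by linarith : (n : ℝ) = 0)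
    subst hn
    refine Or.inl ⟨rfl, ?_⟩
    ext x
    rcases le_total x N with hx | hx
    · exact h2 N le_rfl x hx
    · exact hg.right x hx

theorem IsExpanding.map_eq {M N n : ℕ} {τ : ℝ ≃o ℝ} {A : Type*} [CommGroup A]
    (hτK : τ ∈ dyadicPLOn (-1) (M + 2)) (hτ : ∀ x ∈ Icc (0 : ℝ) M, τ x = x + 1) (hM : N + n = M)
    (φ : dyadicPLOn (-1) (M + 2) →* A) {ξ : A}
    (hξ : ∀ (j : ℕ) (d : dyadicPLOn (-1) (M + 2)), j + 1 ≤ M → IsDoublingAt τ j d → φ d = ξ)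
    {g : dyadicPLOn (-1) (M + 2)} (hg : IsExpanding τ N n g) : φ g = ξ ^ n := by
  induction n generalizing N g with
  | zero =>
    rcases hg.eq_one_or_exists hτ hM with ⟨_, h⟩ | ⟨h, _⟩
    · rw [show g = 1 from Subtype.ext h, map_one, pow_zero]
    · exact absurd h (lt_irrefl 0)
  | succ n ih =>
    rcases hg.eq_one_or_exists hτ hM with ⟨h, _⟩ | ⟨_, j, hj, p, hp⟩
    · exact absurd h n.succ_ne_zero
    · obtain ⟨d, hdK, hd⟩ := exists_isDoublingAt hτK hτ (j := j) (by omega)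
      have h1 : φ (g * (⟨d, hdK⟩ : dyadicPLOn (-1) (M + 2))⁻¹) = ξ ^ n :=
        ih (by omega) (hg.mul_inv hτ (by omega) hj hp hd)
      rw [map_mul, map_inv, hξ j ⟨d, hdK⟩ (by omega) hd, mul_inv_eq_iff_eq_mul] at h1
      rw [h1, pow_succ]

theorem exists_mem_commutator_of_affineOn_unit_intervals {N : ℕ} (hN : 0 < N) {f : ℝ ≃o ℝ}
    (hf : f ∈ dyadicPLOn 0 N)
    (h : ∀ j : ℕ, j < N → ∃ p : ℤ, ∀ x ∈ Icc (j : ℝ) (j + 1), f x = 2 ^ p * (x - j) + f j) :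
    ∃ c d : ℝ, f ∈ ⁅dyadicPLOn c d, dyadicPLOn c d⁆ := by
  choose! p hp using h
  obtain ⟨m, hm⟩ : ∃ m : ℕ, ∀ j < N, 0 ≤ p j + m := by
    refine ⟨(Finset.range N).sup fun j => (-p j).toNat, fun j hj => ?_⟩
    have := Finset.le_sup (f := fun j => (-p j).toNat) (Finset.mem_range.2 hj)
    omega
  obtain ⟨n, hn⟩ : ∃ n, N + n = 2 ^ m * N :=
    ⟨2 ^ m * N - N, by have := Nat.le_mul_of_pos_left N (Nat.two_pow_pos m); omega⟩
  have hnr : (N : ℝ) + n = 2 ^ m * N := by exact_mod_cast hn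
  have hN0 : (0 : ℝ) ≤ N := N.cast_nonneg
  obtain ⟨M, hM⟩ : ∃ M, N + n = M := ⟨_, rfl⟩
  have hMr : (N : ℝ) + n = M := by exact_mod_cast hM
  have hn0 : (0 : ℝ) ≤ n := n.cast_nonneg
  obtain ⟨τ, hτK, -, hτ, -⟩ := exists_dyadicPL_bump (a := -1) (b := M + 2) (p := 0)
    IsDyadic.one.neg (by simpa using IsDyadic.natCast (M + 2)) (by simp; linarith)
  replace hτ : ∀ x ∈ Icc (0 : ℝ) M, τ x = x + 1 := fun x hx => by
    simpa using hτ x (by simpa using hx)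
  obtain ⟨u₁, hu₁, h1, h1'⟩ := exists_dyadicPL_glue (one_mem _)
    (dyadicAffine_mem m IsDyadic.zero) IsDyadic.zero (by simp)
  obtain ⟨u, hu, h2, h2'⟩ := exists_dyadicPL_glue hu₁ (pow_mem hτK n).1 (IsDyadic.natCast N) (by
    rw [h1' _ hN0, pow_translation_apply hτ n hN0 (by linarith)]
    simp [hnr])
  have hul : ∀ x ≤ (0 : ℝ), u x = x := fun x hx => by rw [h2 x (by linarith), h1 x hx]; rfl
  have hum : ∀ x ∈ Icc (0 : ℝ) N, u x = 2 ^ m * x := fun x hx => by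
    rw [h2 x hx.2, h1' x hx.1]; simp
  have huK : u ∈ dyadicPLOn (-1) (M + 2) := ⟨hu, fun x hx => by
    rcases hx with hx | hx
    · exact hul x (by linarith)
    · rw [h2' x (by linarith), (pow_mem hτK n).2 x (Or.inr hx)]⟩
  have hfK : f ∈ dyadicPLOn (-1) (M + 2) := dyadicPLOn_mono (by norm_num) (by linarith) hf
  have hexpu : IsExpanding τ N n u := by
    refine ⟨hul, fun j hj => ⟨m, fun x hx => ?_⟩, h2'⟩
    have hj' : (j : ℝ) + 1 ≤ N := by exact_mod_cast hj
    have hj0 : (0 : ℝ) ≤ j := j.cast_nonneg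
    rw [hum x ⟨hj0.trans hx.1, hx.2.trans hj'⟩, hum j ⟨hj0, by linarith⟩]
    ring
  have hf0 : f 0 = 0 := hf.2 0 (Or.inl le_rfl)
  have hfN : f N = N := hf.2 N (Or.inr le_rfl)
  have hexpuf : IsExpanding τ N n (u * f) := by
    refine ⟨fun x hx => ?_, fun j hj => ?_, fun x hx => ?_⟩
    · rw [RelIso.mul_apply, hf.2 x (Or.inl hx), hul x hx]
    · obtain ⟨q, hq⟩ := Int.eq_ofNat_of_zero_le (hm j hj)
      have hj' : (j : ℝ) + 1 ≤ N := by exact_mod_cast hj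
      have hj0 : (0 : ℝ) ≤ j := j.cast_nonneg
      have hmem : ∀ x ∈ Icc (0 : ℝ) N, f x ∈ Icc (0 : ℝ) N := fun x hx =>
        ⟨by rw [← hf0, f.le_iff_le]; exact hx.1, by rw [← hfN, f.le_iff_le]; exact hx.2⟩
      refine ⟨q, fun x hx => ?_⟩
      rw [RelIso.mul_apply, RelIso.mul_apply, hum _ (hmem x ⟨hj0.trans hx.1, hx.2.trans hj'⟩),
        hum _ (hmem j ⟨hj0, by linarith⟩), hp j hj x hx, ← zpow_natCast (2 : ℝ) q, ← hq,
        zpow_add₀ two_ne_zero, zpow_natCast]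
      ring
    · rw [RelIso.mul_apply, hf.2 x (Or.inr hx), h2' x hx]
  refine ⟨-1, M + 2, ?_⟩
  let φ := Abelianization.of (G := dyadicPLOn (-1) (M + 2))
  have hM1 : 0 + 1 ≤ M := by omega
  obtain ⟨d₀, hd₀K, hd₀⟩ := exists_isDoublingAt hτK hτ hM1
  have hξ : ∀ (j : ℕ) (d : dyadicPLOn (-1) (M + 2)), j + 1 ≤ M → IsDoublingAt τ j d →
      φ d = φ ⟨d₀, hd₀K⟩ := by
    intro j
    induction j with
    | zero =>
      intro d hj hd
      congr 1
      ext x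
      rcases le_total x 0 with hx | hx
      · rw [hd.left x (by simpa), hd₀.left x (by simpa)]
      rcases le_total x 1 with hx1 | hx1
      · rw [hd.mid x (by simp [hx, hx1]), hd₀.mid x (by simp [hx, hx1])]
      · rw [hd.right x (by simpa), hd₀.right x (by simpa)]
    | succ j ih =>
      intro d hj hd
      obtain ⟨e, heK, he⟩ := exists_isDoublingAt hτK hτ (j := j) (by omega)
      rw [← ih ⟨e, heK⟩ (by omega) he]
      have h3 : (⟨τ, hτK⟩ : dyadicPLOn (-1) (M + 2)) * ⟨e, heK⟩ = d * ⟨τ, hτK⟩ :=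
        Subtype.ext (he.mul_eq hτ hj hd)
      have h4 := congrArg φ h3
      rw [map_mul, map_mul, mul_comm] at h4
      exact (mul_right_cancel h4).symm
  have e1 := IsExpanding.map_eq hτK hτ hM φ hξ (g := ⟨u, huK⟩) hexpu
  have e2 := IsExpanding.map_eq hτK hτ hM φ hξ (g := ⟨u, huK⟩ * ⟨f, hfK⟩) hexpuf
  rw [map_mul, e1, mul_eq_left] at e2
  have e3 : (⟨f, hfK⟩ : dyadicPLOn (-1) (M + 2)) ∈ commutator (dyadicPLOn (-1) (M + 2)) := by
    rw [← Abelianization.ker_of]; exact e2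
  rw [← Subgroup.map_subtype_commutator]
  exact ⟨_, e3, rfl⟩

theorem conj_mem_commutator_dyadicPLOn {a b : ℝ} {f g : ℝ ≃o ℝ}
    (hf : f ∈ ⁅dyadicPLOn a b, dyadicPLOn a b⁆) (hg : g ∈ dyadicPL) :
    g * f * g⁻¹ ∈ ⁅dyadicPLOn (g a) (g b), dyadicPLOn (g a) (g b)⁆ := by
  have h1 : (dyadicPLOn a b).map (MulAut.conj g).toMonoidHom ≤ dyadicPLOn (g a) (g b) := by
    rintro _ ⟨k, hk, rfl⟩
    exact conj_mem_dyadicPLOn hk hg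
  have h2 := Subgroup.mem_map_of_mem (MulAut.conj g).toMonoidHom hf
  rw [Subgroup.map_commutator] at h2
  exact Subgroup.commutator_mono h1 h1 h2

theorem exists_mem_commutator_dyadicPLOn {a b : ℝ} {f : ℝ ≃o ℝ} (hf : f ∈ dyadicPLOn a b) :
    ∃ c d : ℝ, f ∈ ⁅dyadicPLOn c d, dyadicPLOn c d⁆ := by
  obtain ⟨S, hS⟩ := hf.1
  obtain ⟨k, hk⟩ := IsDyadic.exists_common_denominator S hS.1
  obtain ⟨R, hR⟩ := exists_nat_ge (-a)
  have hd : IsDyadic (2 ^ k * R) := by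
    exact_mod_cast IsDyadic.natCast (2 ^ k * R)
  set s := dyadicAffine k (2 ^ k * R)
  have hs : s ∈ dyadicPL := dyadicAffine_mem _ hd
  have hsx : ∀ x, s x = 2 ^ k * x + 2 ^ k * R := fun x => by simp [s]
  obtain ⟨N, hN⟩ := exists_nat_ge (max (s b) 1)
  have hN1 : 0 < N := by
    have := (le_max_right _ _).trans hN
    exact_mod_cast zero_lt_one.trans_le this
  have h2k : (0 : ℝ) < 2 ^ k := by positivity
  have hfs : s * f * s⁻¹ ∈ dyadicPLOn 0 N := by
    refine dyadicPLOn_mono ?_ ((le_max_left _ _).trans hN) (conj_mem_dyadicPLOn hf hs)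
    rw [hsx, ← mul_add]
    exact mul_nonneg h2k.le (by linarith)
  obtain ⟨c, d, h⟩ := exists_mem_commutator_of_affineOn_unit_intervals hN1 hfs fun j hj => by
    obtain ⟨p, e, -, hp⟩ := hS.2 (s⁻¹ j) (s⁻¹ (j + 1)) ((OrderIso.lt_iff_lt s⁻¹).2 (by simp))
      fun t ht ht' => by
        obtain ⟨m, hm⟩ := hk t ht
        have h1 := s.lt_iff_lt.2 ht'.1
        have h2 := s.lt_iff_lt.2 ht'.2
        rw [RelIso.apply_inv_self, hsx, hm] at h1 h2
        have h3 : (j : ℤ) < m + 2 ^ k * R := by exact_mod_cast h1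
        have h4 : m + 2 ^ k * R < (j : ℤ) + 1 := by exact_mod_cast h2
        omega
    have key : ∀ x ∈ Icc (j : ℝ) (j + 1),
        (s * f * s⁻¹) x = 2 ^ p * x + (2 ^ k * e + 2 ^ k * R - 2 ^ p * (2 ^ k * R)) := by
      intro x hx
      obtain ⟨y, rfl⟩ := s.surjective x
      have hy : y ∈ Icc (s⁻¹ (j : ℝ)) (s⁻¹ ((j : ℝ) + 1)) := by
        constructor
        · rw [← s.le_iff_le, RelIso.apply_inv_self]; exact hx.1
        · rw [← s.le_iff_le, RelIso.apply_inv_self]; exact hx.2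
      rw [RelIso.mul_apply, RelIso.mul_apply, RelIso.inv_apply_self, hp y hy, hsx, hsx]
      ring
    refine ⟨p, fun x hx => ?_⟩
    rw [key x hx, key j ⟨le_rfl, by linarith⟩]
    ring
  refine ⟨s⁻¹ c, s⁻¹ d, ?_⟩
  have h5 := conj_mem_commutator_dyadicPLOn h (inv_mem hs)
  simpa [mul_assoc] using h5

theorem OrderIso.lt_inv_apply_iff (f : ℝ ≃o ℝ) {x y : ℝ} : x < f⁻¹ y ↔ f x < y := by
  rw [← f.lt_iff_lt, RelIso.apply_inv_self]

theorem OrderIso.inv_apply_lt_iff (f : ℝ ≃o ℝ) {x y : ℝ} : f⁻¹ x < y ↔ x < f y := by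
  rw [← f.lt_iff_lt, RelIso.apply_inv_self]

theorem commute_of_mem_dyadicPLOn {a b c d : ℝ} {f g : ℝ ≃o ℝ} (hf : f ∈ dyadicPLOn a b)
    (hg : g ∈ dyadicPLOn c d) (h : b ≤ c) : Commute f g := by
  ext x
  rw [RelIso.mul_apply, RelIso.mul_apply]
  rcases le_total x c with hx | hx
  · have hfx : f x ≤ c := by
      rw [← hf.2 c (Or.inr h), f.le_iff_le]; exact hx
    rw [hg.2 x (Or.inl hx), hg.2 _ (Or.inl hfx)]
  · have hgx : c ≤ g x := by
      rw [← hg.2 c (Or.inl le_rfl), g.le_iff_le]; exact hx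
    rw [hf.2 x (Or.inr (h.trans hx)), hf.2 _ (Or.inr (h.trans hgx))]

/-- The dyadic piecewise linear homeomorphisms supported in a compact subset of `(0, 1)`. -/
def dyadicPLInner : Subgroup (ℝ ≃o ℝ) where
  carrier := {f | ∃ a b : ℝ, 0 < a ∧ b < 1 ∧ f ∈ dyadicPLOn a b}
  one_mem' := ⟨1, 0, by norm_num, by norm_num, one_mem _⟩
  mul_mem' := fun ⟨a, b, ha, hb, hf⟩ ⟨c, d, hc, hd, hg⟩ => ⟨min a c, max b d, lt_min ha hc,
    max_lt hb hd, mul_mem (dyadicPLOn_mono (min_le_left _ _) (le_max_left _ _) hf)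
      (dyadicPLOn_mono (min_le_right _ _) (le_max_right _ _) hg)⟩
  inv_mem' := fun ⟨a, b, ha, hb, hf⟩ => ⟨a, b, ha, hb, inv_mem hf⟩

theorem dyadicPLOn_le_dyadicPLInner {a b : ℝ} (ha : 0 < a) (hb : b < 1) :
    dyadicPLOn a b ≤ dyadicPLInner := fun _ hf => ⟨a, b, ha, hb, hf⟩

theorem dyadicPLInner_le : dyadicPLInner ≤ dyadicPLOn 0 1 :=
  fun _ ⟨_, _, ha, hb, hf⟩ => dyadicPLOn_mono ha.le hb.le hf

theorem exists_contraction (a b c d : ℝ) (ha : 0 < a) (hb : b < 1) :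
    ∃ g ∈ dyadicPL, 0 < g c ∧ g d < 1 ∧ ∀ f ∈ dyadicPLOn a b, g * f * g⁻¹ = f := by
  obtain ⟨a', ha', ha0, haa⟩ := IsDyadic.exists_between
    (lt_min ha (by norm_num : (0 : ℝ) < 1 / 2))
  obtain ⟨b', hb', hbb, hb1⟩ := IsDyadic.exists_between
    (max_lt hb (by norm_num : (1 / 2 : ℝ) < 1))
  have hab : a' < b' := haa.trans_le ((min_le_right _ _).trans ((le_max_right _ _).trans hbb.le))
  have haa' : a' ≤ a := haa.le.trans (min_le_left _ _)
  have hbb' : b ≤ b' := (le_max_left _ _).trans hbb.le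
  obtain ⟨q, hq⟩ := IsDyadic.exists_two_zpow_lt (x := min a' (1 - b') / (|c| + |d| + 2))
    (div_pos (lt_min ha0 (by linarith)) (by positivity))
  rw [lt_div_iff₀ (by positivity)] at hq
  have hq1 := hq.trans_le (min_le_left _ _)
  have hq2 := hq.trans_le (min_le_right _ _)
  have hq0 : (0 : ℝ) < 2 ^ q := by positivity
  have hd := IsDyadic.two_zpow q
  obtain ⟨g₁, hg₁, h1, h1'⟩ := exists_dyadicPL_glue
    (dyadicAffine_mem q (ha'.sub (hd.mul ha'))) (one_mem _) ha' (by simp)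
  obtain ⟨g, hg, h2, h2'⟩ := exists_dyadicPL_glue hg₁
    (dyadicAffine_mem q (hb'.sub (hd.mul hb'))) hb' (by rw [h1' _ hab.le]; simp)
  have hga : ∀ x ≤ a', g x = a' + 2 ^ q * (x - a') := fun x hx => by
    rw [h2 x (by linarith), h1 x hx, dyadicAffine_apply]; ring
  have hgm : ∀ x, a' ≤ x → x ≤ b' → g x = x := fun x hx hx' => by
    rw [h2 x hx', h1' x hx]; rfl
  have hgb : ∀ x, b' ≤ x → g x = b' + 2 ^ q * (x - b') := fun x hx => by
    rw [h2' x hx, dyadicAffine_apply]; ring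
  have ha1 : a' < 1 := hab.trans hb1
  refine ⟨g, hg, ?_, ?_, fun f hf => ?_⟩
  · rcases le_total c a' with hc | hc
    · rw [hga c hc]
      have : 2 ^ q * (a' - c) ≤ 2 ^ q * (|c| + |d| + 2) := by
        gcongr
        linarith [neg_abs_le c, abs_nonneg d]
      linarith
    · rw [← g.le_iff_le, hgm a' le_rfl hab.le] at hc
      linarith
  · rcases le_total b' d with hc | hc
    · rw [hgb d hc]
      have : 2 ^ q * (d - b') ≤ 2 ^ q * (|c| + |d| + 2) := by
        gcongr
        linarith [le_abs_self d, abs_nonneg c]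
      linarith
    · rw [← g.le_iff_le, hgm b' hab.le le_rfl] at hc
      linarith
  · rw [mul_inv_eq_iff_eq_mul]
    ext x
    rw [RelIso.mul_apply, RelIso.mul_apply]
    have hfa : f a' = a' := hf.2 a' (Or.inl haa')
    have hfb : f b' = b' := hf.2 b' (Or.inr hbb')
    rcases le_total x a' with hx | hx
    · have : g x ≤ a' := by rwa [← hgm a' le_rfl hab.le, g.le_iff_le]
      rw [hf.2 x (Or.inl (hx.trans haa')), hf.2 (g x) (Or.inl (this.trans haa'))]
    rcases le_total x b' with hx' | hx'
    · rw [hgm x hx hx', hgm]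
      · rwa [← hfa, f.le_iff_le]
      · rwa [← hfb, f.le_iff_le]
    · have : b' ≤ g x := by rwa [← hgm b' hab.le le_rfl, g.le_iff_le]
      rw [hf.2 x (Or.inr (hbb'.trans hx')), hf.2 (g x) (Or.inr (hbb'.trans this))]

theorem dyadicPLInner_le_commutator : dyadicPLInner ≤ ⁅dyadicPLInner, dyadicPLInner⁆ := by
  rintro f ⟨a, b, ha, hb, hf⟩
  obtain ⟨c, d, h⟩ := exists_mem_commutator_dyadicPLOn hf
  obtain ⟨g, hg, hc, hd, hgf⟩ := exists_contraction a b c d ha hb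
  have h1 := conj_mem_commutator_dyadicPLOn h hg
  rw [hgf f hf] at h1
  have h2 := dyadicPLOn_le_dyadicPLInner hc hd
  exact Subgroup.commutator_mono h2 h2 h1

/-- `f` fixes `x`, and near `x` in the direction `σ` it is linear with slope `2 ^ p`. -/
def HasGerm (f : ℝ ≃o ℝ) (x σ : ℝ) (p : ℤ) : Prop :=
  ∃ ε > 0, ∀ t ∈ Icc 0 ε, f (x + σ * t) = x + 2 ^ p * (σ * t)

namespace HasGerm

variable {f g : ℝ ≃o ℝ} {x σ : ℝ} {p q : ℤ}

theorem unique (hσ : σ ≠ 0) (hf : HasGerm f x σ p) (hf' : HasGerm f x σ q) : p = q := by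
  obtain ⟨ε, hε, h⟩ := hf
  obtain ⟨δ, hδ, h'⟩ := hf'
  have h0 : 0 < min ε δ := lt_min hε hδ
  have h1 := h (min ε δ) ⟨h0.le, min_le_left _ _⟩
  rw [h' (min ε δ) ⟨h0.le, min_le_right _ _⟩] at h1
  have h2 : (2 : ℝ) ^ q = 2 ^ p := mul_right_cancel₀ (mul_ne_zero hσ h0.ne') (by linarith)
  exact (zpow_right_injective₀ (by norm_num) (by norm_num) h2).symm

theorem mul (hf : HasGerm f x σ p) (hg : HasGerm g x σ q) : HasGerm (f * g) x σ (p + q) := by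
  obtain ⟨ε, hε, h⟩ := hf
  obtain ⟨δ, hδ, h'⟩ := hg
  refine ⟨min δ (ε / 2 ^ q), lt_min hδ (by positivity), fun t ht => ?_⟩
  have h1 : 2 ^ q * t ≤ ε := by
    have := ht.2.trans (min_le_right _ _)
    rwa [le_div_iff₀ (by positivity), mul_comm] at this
  rw [RelIso.mul_apply, h' t ⟨ht.1, ht.2.trans (min_le_left _ _)⟩, mul_left_comm,
    h _ ⟨mul_nonneg (by positivity) ht.1, h1⟩, zpow_add₀ two_ne_zero]
  ring

theorem exists_of_isFixed (hf : f ∈ dyadicPL) (hx : f x = x) (hσ : σ = 1 ∨ σ = -1) :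
    ∃ p, HasGerm f x σ p := by
  obtain ⟨S, hS⟩ := hf
  rcases hσ with rfl | rfl
  · obtain ⟨b, hb, h⟩ := S.exists_gt_forall_notMem_Ioo x
    obtain ⟨p, c, -, hp⟩ := hS.2 x b hb h
    refine ⟨p, b - x, sub_pos.2 hb, fun t ht => ?_⟩
    have := hp x ⟨le_rfl, hb.le⟩
    rw [hp _ ⟨by linarith [ht.1], by linarith [ht.2]⟩]
    linarith
  · obtain ⟨b, hb, h⟩ := S.exists_lt_forall_notMem_Ioo x
    obtain ⟨p, c, -, hp⟩ := hS.2 b x hb h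
    refine ⟨p, x - b, sub_pos.2 hb, fun t ht => ?_⟩
    have := hp x ⟨hb.le, le_rfl⟩
    rw [hp _ ⟨by linarith [ht.2], by linarith [ht.1]⟩]
    linarith

end HasGerm

/-- The logarithm of the slope at a common fixed point is a homomorphism. -/
theorem exists_germHom (G : Subgroup (ℝ ≃o ℝ)) (hG : G ≤ dyadicPL) {x σ : ℝ}
    (hx : ∀ g ∈ G, g x = x) (hσ : σ = 1 ∨ σ = -1) :
    ∃ φ : G →* Multiplicative ℤ, ∀ g : G, HasGerm g x σ (φ g).toAdd := by
  choose p hp using fun g : G => HasGerm.exists_of_isFixed (hG g.2) (hx g g.2) hσ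
  have hσ0 : σ ≠ 0 := by rcases hσ with rfl | rfl <;> norm_num
  exact ⟨MonoidHom.mk' (fun g => Multiplicative.ofAdd (p g)) fun g h =>
    congrArg Multiplicative.ofAdd ((hp (g * h)).unique hσ0 ((hp g).mul (hp h))), hp⟩

theorem mem_dyadicPLInner_of_hasGerm {f : ℝ ≃o ℝ} (hf : f ∈ dyadicPLOn 0 1)
    (h0 : HasGerm f 0 1 0) (h1 : HasGerm f 1 (-1) 0) : f ∈ dyadicPLInner := by
  obtain ⟨ε, hε, h⟩ := h0
  obtain ⟨δ, hδ, h'⟩ := h1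
  refine ⟨ε, 1 - δ, hε, by linarith, hf.1, fun x hx => ?_⟩
  rcases hx with hx | hx
  · rcases le_total x 0 with hx0 | hx0
    · exact hf.2 x (Or.inl hx0)
    · simpa using h x ⟨hx0, hx⟩
  · rcases le_total 1 x with hx0 | hx0
    · exact hf.2 x (Or.inr hx0)
    · simpa using h' (1 - x) ⟨by linarith, by linarith⟩

theorem exists_slopeHom : ∃ φ : dyadicPLOn 0 1 →* Multiplicative ℤ × Multiplicative ℤ,
    Function.Surjective φ ∧ ∀ f : dyadicPLOn 0 1, φ f = 1 → (f : ℝ ≃o ℝ) ∈ dyadicPLInner := by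
  obtain ⟨φ, hφ⟩ := exists_germHom (dyadicPLOn 0 1) (fun f hf => hf.1) (x := 0) (σ := 1)
    (fun f hf => hf.2 0 (Or.inl le_rfl)) (Or.inl rfl)
  obtain ⟨ψ, hψ⟩ := exists_germHom (dyadicPLOn 0 1) (fun f hf => hf.1) (x := 1) (σ := -1)
    (fun f hf => hf.2 1 (Or.inr le_rfl)) (Or.inr rfl)
  refine ⟨φ.prod ψ, ?_, fun f hf => ?_⟩
  · have hh : IsDyadic (1 / 2) := by simpa using IsDyadic.two_zpow (-1)
    obtain ⟨A, hA, hA1, -, -⟩ := exists_dyadicPL_bump (a := 0) (b := 1 / 2) (p := -3)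
      IsDyadic.zero hh (by norm_num)
    obtain ⟨B, hB, -, -, hB1⟩ := exists_dyadicPL_bump (a := 1 / 2) (b := 1) (p := -3)
      hh IsDyadic.one (by norm_num)
    have hA' : A ∈ dyadicPLOn 0 1 := dyadicPLOn_mono le_rfl (by norm_num) hA
    have hB' : B ∈ dyadicPLOn 0 1 := dyadicPLOn_mono (by norm_num) le_rfl hB
    have e1 : (φ ⟨A, hA'⟩).toAdd = 1 :=
      (hφ ⟨A, hA'⟩).unique one_ne_zero ⟨2 ^ (-3 : ℤ), by positivity, fun t ht => by
        rw [hA1 _ (by simpa using ht)]; simp⟩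
    have e2 : (ψ ⟨A, hA'⟩).toAdd = 0 :=
      (hψ ⟨A, hA'⟩).unique (by norm_num) ⟨1 / 2, by norm_num, fun t ht => by
        rw [hA.2 _ (Or.inr (by linarith [ht.2]))]; simp⟩
    have e3 : (φ ⟨B, hB'⟩).toAdd = 0 :=
      (hφ ⟨B, hB'⟩).unique one_ne_zero ⟨1 / 2, by norm_num, fun t ht => by
        rw [hB.2 _ (Or.inl (by linarith [ht.2]))]; simp⟩
    have e4 : (ψ ⟨B, hB'⟩).toAdd = -1 :=
      (hψ ⟨B, hB'⟩).unique (by norm_num) ⟨2 * 2 ^ (-3 : ℤ), by positivity, fun t ht => by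
        rw [hB1 _ ⟨by linarith [ht.2], by linarith [ht.1]⟩]; simp; ring⟩
    rintro ⟨a, b⟩
    refine ⟨⟨A, hA'⟩ ^ a.toAdd * ⟨B, hB'⟩ ^ (-b.toAdd), ?_⟩
    refine Prod.ext (Multiplicative.toAdd.injective ?_) (Multiplicative.toAdd.injective ?_) <;>
      simp [e1, e2, e3, e4]
  · rw [MonoidHom.prod_apply, Prod.mk_eq_one] at hf
    refine mem_dyadicPLInner_of_hasGerm f.2 ?_ ?_
    · simpa [hf.1] using hφ f
    · simpa [hf.2] using hψ f

theorem map_commutator_dyadicPLOn :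
    (commutator (dyadicPLOn 0 1)).map (dyadicPLOn 0 1).subtype = dyadicPLInner := by
  apply le_antisymm
  · obtain ⟨φ, -, hφ⟩ := exists_slopeHom
    rintro _ ⟨f, hf, rfl⟩
    exact hφ f (Abelianization.commutator_subset_ker φ hf)
  · rw [Subgroup.map_subtype_commutator]
    exact dyadicPLInner_le_commutator.trans
      (Subgroup.commutator_mono dyadicPLInner_le dyadicPLInner_le)

theorem nonempty_abelianization_dyadicPLOn :
    Nonempty (Abelianization (dyadicPLOn 0 1) ≃* Multiplicative (ℤ × ℤ)) := by
  obtain ⟨φ, hφs, hφ⟩ := exists_slopeHom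
  have h : commutator (dyadicPLOn 0 1) = φ.ker := by
    refine le_antisymm (Abelianization.commutator_subset_ker φ) fun f hf => ?_
    have := hφ f hf
    rw [← map_commutator_dyadicPLOn] at this
    obtain ⟨g, hg, hgf⟩ := this
    rwa [← Subtype.ext hgf]
  exact ⟨(QuotientGroup.quotientMulEquivOfEq h).trans
    ((QuotientGroup.quotientKerEquivOfSurjective φ hφs).trans
      (MulEquiv.prodMultiplicative ℤ ℤ).symm)⟩

theorem commutatorElement_mem_of_commute_conj {G : Type*} [Group G] {N : Subgroup G} [N.Normal]
    {γ g h : G} (hγ : γ ∈ N) (hc : Commute g (γ * h * γ⁻¹)) : ⁅g, h⁆ ∈ N := by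
  rw [← QuotientGroup.eq_one_iff] at hγ ⊢
  have h1 := hc.map (QuotientGroup.mk' N)
  simp only [map_mul, map_inv, QuotientGroup.mk'_apply, hγ, one_mul, inv_one, mul_one] at h1
  exact commutatorElement_eq_one_iff_commute.2 h1

theorem exists_dyadicPLInner_squeeze {a b c d : ℝ} (ha : 0 < a) (hb : b < 1) (hc : 0 < c)
    (hcd : c < d) (hd : d < 1) : ∃ ρ ∈ dyadicPLInner, c < ρ a ∧ ρ b < d := by
  obtain ⟨q, hq, hcq, hqd⟩ := IsDyadic.exists_between hcd
  obtain ⟨δ, hδ, hδ0, hδ'⟩ := IsDyadic.exists_between (lt_min ha hc)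
  rw [lt_min_iff] at hδ'
  obtain ⟨θ, hθ, hθ'⟩ := exists_dyadicPL_lt_apply hδ hq (hδ'.2.trans hcq)
  obtain ⟨m, hm⟩ := θ.exists_lt_pow_apply (a := a) (b := c) fun x hx =>
    hθ' x ⟨by linarith [hx.1], by linarith [hx.2]⟩
  have hθm := pow_mem hθ m
  have hb1 : (θ ^ m) b < 1 := by
    rw [← hθm.2 1 (Or.inr (hqd.trans hd).le), OrderIso.lt_iff_lt]; exact hb
  obtain ⟨ω, hω, hω', hω1⟩ := IsDyadic.exists_between (max_lt hb1 hd)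
  rw [max_lt_iff] at hω'
  obtain ⟨η, hη, hη'⟩ := exists_dyadicPL_lt_apply hq hω (hqd.trans hω'.2)
  obtain ⟨n, hn⟩ := η.exists_lt_pow_apply (a := d) (b := (θ ^ m) b) fun x hx =>
    hη' x ⟨by linarith [hx.1], by linarith [hx.2]⟩
  have hηn := pow_mem hη n
  refine ⟨(η ^ n)⁻¹ * θ ^ m, mul_mem (inv_mem ⟨q, ω, by linarith, hω1, hηn⟩)
    ⟨δ, q, hδ0, by linarith, hθm⟩, ?_, ?_⟩
  · rw [RelIso.mul_apply, OrderIso.lt_inv_apply_iff, hηn.2 c (Or.inl hcq.le)]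
    exact hm
  · rw [RelIso.mul_apply, OrderIso.inv_apply_lt_iff]
    exact hn

theorem isSimpleGroup_dyadicPLInner : IsSimpleGroup dyadicPLInner := by
  have hperf : commutator dyadicPLInner = ⊤ := by
    rw [eq_top_iff]
    intro f _
    have := dyadicPLInner_le_commutator f.2
    rw [← Subgroup.map_subtype_commutator] at this
    obtain ⟨g, hg, hgf⟩ := this
    rwa [← Subtype.ext hgf]
  have : Nontrivial dyadicPLInner := by
    obtain ⟨f, hf, hf'⟩ := exists_dyadicPL_lt_apply (a := 1 / 4) (b := 1 / 2)
      ⟨1, 2, by norm_num⟩ ⟨1, 1, by norm_num⟩ (by norm_num)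
    refine ⟨⟨f, 1 / 4, 1 / 2, by norm_num, by norm_num, hf⟩, 1, fun h => ?_⟩
    have h1 := hf' (3 / 8) (by norm_num)
    have h2 : f = 1 := congrArg Subtype.val h
    rw [h2] at h1
    exact lt_irrefl _ h1
  refine ⟨fun N hN => or_iff_not_imp_left.2 fun hbot => ?_⟩
  obtain ⟨γ, hγ, x, hx⟩ : ∃ γ ∈ N, ∃ x : ℝ, x < (γ : ℝ ≃o ℝ) x := by
    obtain ⟨γ, hγ, hγ1⟩ := N.bot_or_exists_ne_one.resolve_left hbot
    obtain ⟨x, hx⟩ : ∃ x, (γ : ℝ ≃o ℝ) x ≠ x := by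
      by_contra! h
      exact hγ1 (Subtype.ext (RelIso.ext h))
    rcases hx.lt_or_gt with h | h
    · exact ⟨γ⁻¹, inv_mem hγ, x, (OrderIso.lt_inv_apply_iff _).2 h⟩
    · exact ⟨γ, hγ, x, h⟩
  have hγF := dyadicPLInner_le γ.2
  have hx0 : 0 < x := not_le.1 fun h => hx.ne' (hγF.2 x (Or.inl h))
  have hx1 : x < 1 := not_le.1 fun h => hx.ne' (hγF.2 x (Or.inr h))
  obtain ⟨d, hxd, hd⟩ := exists_between (lt_min hx hx1)
  rw [lt_min_iff] at hd
  obtain ⟨c, hc, hcx⟩ := exists_between (max_lt ((OrderIso.inv_apply_lt_iff _).2 hd.1) hx0)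
  rw [max_lt_iff, OrderIso.inv_apply_lt_iff] at hc
  rw [eq_top_iff, ← hperf, commutator_def, Subgroup.commutator_le]
  rintro ⟨g, a, b, ha, hb, hg⟩ - ⟨h, a', b', ha', hb', hh⟩ -
  obtain ⟨ρ, hρ, h1, h2⟩ := exists_dyadicPLInner_squeeze (a := min a a') (b := max b b')
    (lt_min ha ha') (max_lt hb hb') hc.2 (hcx.trans hxd) hd.2
  have hγ' : (⟨ρ, hρ⟩ : dyadicPLInner)⁻¹ * γ * ⟨ρ, hρ⟩ ∈ N := by
    simpa using hN.conj_mem γ hγ (⟨ρ, hρ⟩ : dyadicPLInner)⁻¹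
  refine commutatorElement_mem_of_commute_conj hγ' ?_
  have hγP : (ρ⁻¹ * γ * ρ : ℝ ≃o ℝ) ∈ dyadicPL :=
    mul_mem (mul_mem (inv_mem (dyadicPLInner_le hρ).1) hγF.1) (dyadicPLInner_le hρ).1
  refine Subtype.ext (commute_of_mem_dyadicPLOn hg (conj_mem_dyadicPLOn hh hγP) ?_).eq
  simp only [RelIso.mul_apply]
  have h3 : ρ b ≤ ρ (max b b') := ρ.monotone (le_max_left _ _)
  have h4 : ρ (min a a') ≤ ρ a' := ρ.monotone (min_le_right _ _)
  have h5 : (γ : ℝ ≃o ℝ) c < (γ : ℝ ≃o ℝ) (ρ a') := OrderIso.lt_iff_lt _ |>.2 (h1.trans_le h4)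
  exact ((OrderIso.lt_inv_apply_iff _).2 (by linarith [hc.1])).le

theorem FreeGroup.commute_of_iff {α : Type*} {a b : α} :
    Commute (FreeGroup.of a) (FreeGroup.of b) ↔ a = b := by
  refine ⟨fun h => ?_, fun h => h ▸ Commute.refl _⟩
  by_contra hab
  classical
  have h1 := h.map (FreeGroup.lift fun i => if i = a then Equiv.swap (0 : Fin 3) 1
    else Equiv.swap 1 2)
  rw [FreeGroup.lift_apply_of, FreeGroup.lift_apply_of, if_pos rfl, if_neg (Ne.symm hab)] at h1
  revert h1
  unfold Commute SemiconjBy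
  decide

theorem IsFreeGroup.isCyclic_of_forall_commute {G : Type*} [Group G] [IsFreeGroup G]
    (h : ∀ x y : G, Commute x y) : IsCyclic G := by
  have h1 : Subsingleton (IsFreeGroup.Generators G) := ⟨fun a b =>
    FreeGroup.commute_of_iff.1 <| by
      simpa using (h ((IsFreeGroup.mulEquiv G) (FreeGroup.of a))
        ((IsFreeGroup.mulEquiv G) (FreeGroup.of b))).map (IsFreeGroup.mulEquiv G).symm⟩
  have : IsCyclic (FreeGroup (IsFreeGroup.Generators G)) := by
    cases isEmpty_or_nonempty (IsFreeGroup.Generators G) with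
    | inl h => infer_instance
    | inr h =>
      have := uniqueOfSubsingleton h.some
      infer_instance
  exact isCyclic_of_surjective _ (IsFreeGroup.mulEquiv G).surjective

theorem IsFreeGroup.exists_zpow_of_commute {G : Type*} [Group G] [IsFreeGroup G] {x y : G}
    (h : Commute x y) : ∃ z : G, (∃ m : ℤ, z ^ m = x) ∧ ∃ n : ℤ, z ^ n = y := by
  have hx : x ∈ Subgroup.closure {x, y} := Subgroup.subset_closure (by simp)
  have hy : y ∈ Subgroup.closure {x, y} := Subgroup.subset_closure (by simp)
  have hc : ∀ a ∈ ({x, y} : Set G), ∀ b ∈ ({x, y} : Set G), a * b = b * a := by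
    rintro a (rfl | rfl) b (rfl | rfl)
    exacts [rfl, h.eq, h.eq.symm, rfl]
  have hcomm := Subgroup.isMulCommutative_closure hc
  have := IsFreeGroup.isCyclic_of_forall_commute (G := Subgroup.closure {x, y})
    fun a b => mul_comm' a b
  obtain ⟨z, hz⟩ := IsCyclic.exists_zpow_surjective (G := Subgroup.closure {x, y})
  obtain ⟨m, hm⟩ := hz ⟨x, hx⟩
  obtain ⟨n, hn⟩ := hz ⟨y, hy⟩
  exact ⟨z, ⟨m, congrArg Subtype.val hm⟩, n, congrArg Subtype.val hn⟩

/-- The supremum of a bounded orbit is a common fixed point. -/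
theorem apply_sSup_orbit {G : Subgroup (ℝ ≃o ℝ)} {x : ℝ}
    (hb : BddAbove {y | ∃ g ∈ G, g x = y}) {g : ℝ ≃o ℝ} (hg : g ∈ G) :
    g (sSup {y | ∃ g ∈ G, g x = y}) = sSup {y | ∃ g ∈ G, g x = y} := by
  have hne : {y | ∃ g ∈ G, g x = y}.Nonempty := ⟨x, 1, one_mem G, rfl⟩
  rw [OrderIso.map_csSup' g hne hb]
  congr 1
  ext y
  constructor
  · rintro ⟨_, ⟨h, hh, rfl⟩, rfl⟩
    exact ⟨g * h, mul_mem hg hh, rfl⟩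
  · rintro ⟨h, hh, rfl⟩
    exact ⟨(g⁻¹ * h) x, ⟨_, mul_mem (inv_mem hg) hh, rfl⟩, by
      rw [← RelIso.mul_apply, mul_inv_cancel_left]⟩

theorem apply_sInf_orbit {G : Subgroup (ℝ ≃o ℝ)} {x : ℝ}
    (hb : BddBelow {y | ∃ g ∈ G, g x = y}) {g : ℝ ≃o ℝ} (hg : g ∈ G) :
    g (sInf {y | ∃ g ∈ G, g x = y}) = sInf {y | ∃ g ∈ G, g x = y} := by
  have hne : {y | ∃ g ∈ G, g x = y}.Nonempty := ⟨x, 1, one_mem G, rfl⟩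
  rw [OrderIso.map_csInf' g hne hb]
  congr 1
  ext y
  constructor
  · rintro ⟨_, ⟨h, hh, rfl⟩, rfl⟩
    exact ⟨g * h, mul_mem hg hh, rfl⟩
  · rintro ⟨h, hh, rfl⟩
    exact ⟨(g⁻¹ * h) x, ⟨_, mul_mem (inv_mem hg) hh, rfl⟩, by
      rw [← RelIso.mul_apply, mul_inv_cancel_left]⟩

theorem bddAbove_orbit {G : Subgroup (ℝ ≃o ℝ)} {a b : ℝ} (hG : G ≤ dyadicPLOn a b) (x : ℝ) :
    BddAbove {y | ∃ g ∈ G, g x = y} := by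
  refine ⟨max x b, ?_⟩
  rintro _ ⟨g, hg, rfl⟩
  calc g x ≤ g (max x b) := g.monotone (le_max_left _ _)
    _ = max x b := (hG hg).2 _ (Or.inr (le_max_right _ _))

theorem bddBelow_orbit {G : Subgroup (ℝ ≃o ℝ)} {a b : ℝ} (hG : G ≤ dyadicPLOn a b) (x : ℝ) :
    BddBelow {y | ∃ g ∈ G, g x = y} := by
  refine ⟨min x a, ?_⟩
  rintro _ ⟨g, hg, rfl⟩
  calc min x a = g (min x a) := ((hG hg).2 _ (Or.inl (min_le_right _ _))).symm
    _ ≤ g x := g.monotone (min_le_left _ _)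

/-- The convex hull of an orbit. -/
def orbitHull (G : Subgroup (ℝ ≃o ℝ)) (s : ℝ) : Set ℝ :=
  {x | (∃ g ∈ G, g s ≤ x) ∧ ∃ g ∈ G, x ≤ g s}

theorem apply_mem_orbitHull {G : Subgroup (ℝ ≃o ℝ)} {s x : ℝ} {g : ℝ ≃o ℝ} (hg : g ∈ G)
    (hx : x ∈ orbitHull G s) : g x ∈ orbitHull G s := by
  obtain ⟨⟨h, hh, h1⟩, k, hk, h2⟩ := hx
  exact ⟨⟨g * h, mul_mem hg hh, g.monotone h1⟩, g * k, mul_mem hg hk, g.monotone h2⟩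

theorem eq_of_mem_orbitHull {G : Subgroup (ℝ ≃o ℝ)} {s x : ℝ} (hx : x ∈ orbitHull G s)
    (h : ∀ g ∈ G, g x = x) : x = s := by
  obtain ⟨⟨k, hk, h1⟩, l, hl, h2⟩ := hx
  rw [← h k hk, k.le_iff_le] at h1
  rw [← h l hl, l.le_iff_le] at h2
  exact le_antisymm h2 h1

theorem exists_lt_apply_of_mem_orbitHull {G : Subgroup (ℝ ≃o ℝ)} {a b s c d : ℝ}
    (hG : G ≤ dyadicPLOn a b) (hs : ∃ g ∈ G, g s ≠ s) (hc : c ∈ orbitHull G s)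
    (hd : d ∈ orbitHull G s) : ∃ g ∈ G, d < g c := by
  by_contra! h
  have hb := bddAbove_orbit hG c
  have hfix := fun g hg => apply_sSup_orbit hb (g := g) hg
  set M := sSup {y | ∃ g ∈ G, g c = y}
  have hcM : c ≤ M := le_csSup hb ⟨1, one_mem G, rfl⟩
  have hMd : M ≤ d := csSup_le ⟨c, 1, one_mem G, rfl⟩ (by rintro _ ⟨g, hg, rfl⟩; exact h g hg)
  have hM : M ∈ orbitHull G s := by
    obtain ⟨⟨k, hk, h1⟩, -⟩ := hc
    obtain ⟨-, l, hl, h2⟩ := hd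
    exact ⟨⟨k, hk, h1.trans hcM⟩, l, hl, hMd.trans h2⟩
  obtain ⟨g, hg, hgs⟩ := hs
  rw [eq_of_mem_orbitHull hM hfix] at hfix
  exact hgs (hfix g hg)

theorem hasGerm_zero_of_mem_commutator {G : Subgroup (ℝ ≃o ℝ)} (hG : G ≤ dyadicPL) {x σ : ℝ}
    (hx : ∀ g ∈ G, g x = x) (hσ : σ = 1 ∨ σ = -1) {w : G} (hw : w ∈ commutator G) :
    HasGerm w x σ 0 := by
  obtain ⟨φ, hφ⟩ := exists_germHom G hG hx hσ
  have := hφ w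
  rwa [(MonoidHom.mem_ker).1 (Abelianization.commutator_subset_ker φ hw)] at this

theorem exists_support_of_mem_commutator {G : Subgroup (ℝ ≃o ℝ)} {a b : ℝ}
    (hG : G ≤ dyadicPLOn a b) (s : ℝ) {w : G} (hw : w ∈ commutator G) :
    ∃ c ∈ orbitHull G s, ∃ d ∈ orbitHull G s,
      ∀ x ∈ orbitHull G s, x ≤ c ∨ d ≤ x → (w : ℝ ≃o ℝ) x = x := by
  have hG' : G ≤ dyadicPL := fun g hg => (hG hg).1
  have hne : {y | ∃ g ∈ G, g s = y}.Nonempty := ⟨s, 1, one_mem G, rfl⟩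
  have hA := bddAbove_orbit hG s
  have hB := bddBelow_orbit hG s
  obtain ⟨ε, hε, h⟩ := hasGerm_zero_of_mem_commutator hG'
    (fun g hg => apply_sInf_orbit hB hg) (Or.inl rfl) hw
  obtain ⟨δ, hδ, h'⟩ := hasGerm_zero_of_mem_commutator hG'
    (fun g hg => apply_sSup_orbit hA hg) (Or.inr rfl) hw
  set α := sInf {y | ∃ g ∈ G, g s = y}
  set β := sSup {y | ∃ g ∈ G, g s = y}
  obtain ⟨_, ⟨k, hk, rfl⟩, hkα⟩ := exists_lt_of_csInf_lt hne (lt_add_of_pos_right α hε)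
  obtain ⟨_, ⟨l, hl, rfl⟩, hlβ⟩ := exists_lt_of_lt_csSup hne (sub_lt_self β hδ)
  refine ⟨k s, ⟨⟨k, hk, le_rfl⟩, k, hk, le_rfl⟩, l s, ⟨⟨l, hl, le_rfl⟩, l, hl, le_rfl⟩, ?_⟩
  rintro x ⟨⟨m, hm, h1⟩, n, hn, h2⟩ (hx | hx)
  · have := h (x - α) ⟨sub_nonneg.2 ((csInf_le hB ⟨m, hm, rfl⟩).trans h1), by linarith⟩
    simpa using this
  · have := h' (β - x) ⟨sub_nonneg.2 (h2.trans (le_csSup hA ⟨n, hn, rfl⟩)), by linarith⟩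
    simpa using this

theorem OrderIso.zpow_apply_of_apply_eq {f : ℝ ≃o ℝ} {x : ℝ} (h : f x = x) (n : ℤ) :
    (f ^ n) x = x := by
  have : f ∈ MulAction.stabilizer (ℝ ≃o ℝ) x := h
  exact zpow_mem this n

theorem OrderIso.eq_zero_of_zpow_apply_eq {f : ℝ ≃o ℝ} {x : ℝ} (h : f x ≠ x) {n : ℤ}
    (hn : (f ^ n) x = x) : n = 0 := by
  have key : ∀ (g : ℝ ≃o ℝ), x < g x → ∀ m : ℕ, x < (g ^ (m + 1)) x := by
    intro g hg m
    induction m with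
    | zero => simpa using hg
    | succ m ih =>
      rw [pow_succ', RelIso.mul_apply]
      exact hg.trans (g.strictMono ih)
  have key' : ∀ m : ℕ, (f ^ (m + 1)) x ≠ x := by
    intro m hm
    rcases h.lt_or_gt with h | h
    · have h1 := key f⁻¹ ((OrderIso.lt_inv_apply_iff _).2 h) m
      rw [inv_pow, OrderIso.lt_inv_apply_iff, hm] at h1
      exact lt_irrefl _ h1
    · exact (key f h m).ne' hm
  have hk : ∀ k : ℕ, (f ^ k) x = x → k = 0 := fun k hk => by
    by_contra h0
    obtain ⟨m, rfl⟩ := Nat.exists_eq_succ_of_ne_zero h0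
    exact key' m hk
  obtain ⟨k, rfl | rfl⟩ := n.eq_nat_or_neg
  · rw [zpow_natCast] at hn
    rw [hk k hn, Nat.cast_zero]
  · have := OrderIso.zpow_apply_of_apply_eq hn (-1)
    rw [← zpow_mul, neg_mul_neg, mul_one, zpow_natCast] at this
    rw [hk k this, Nat.cast_zero, neg_zero]

theorem exists_commutator_trivial_on_orbitHull {G : Subgroup (ℝ ≃o ℝ)} {a b : ℝ}
    (hG : G ≤ dyadicPLOn a b) [IsFreeGroup G] {w : G} (hw : w ∈ commutator G) (hw1 : w ≠ 1)
    (s : ℝ) : ∃ v ∈ commutator G, v ≠ 1 ∧ (∀ x ∈ orbitHull G s, (v : ℝ ≃o ℝ) x = x) ∧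
      ∀ t, (∀ x ∈ orbitHull G t, (w : ℝ ≃o ℝ) x = x) →
        ∀ x ∈ orbitHull G t, (v : ℝ ≃o ℝ) x = x := by
  by_cases h : ∀ x ∈ orbitHull G s, (w : ℝ ≃o ℝ) x = x
  · exact ⟨w, hw, hw1, h, fun t ht => ht⟩
  push Not at h
  obtain ⟨x₀, hx₀, hwx₀⟩ := h
  have hs : ∃ g ∈ G, g s ≠ s := by
    by_contra! hs
    obtain ⟨⟨k, hk, h1⟩, l, hl, h2⟩ := hx₀
    rw [hs k hk] at h1
    rw [hs l hl] at h2
    obtain rfl := le_antisymm h1 h2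
    exact hwx₀ (hs _ w.2)
  obtain ⟨c, hc, d, hd, hcd⟩ := exists_support_of_mem_commutator hG s hw
  obtain ⟨h, hh, hdh⟩ := exists_lt_apply_of_mem_orbitHull hG hs hc hd
  have hwc := hcd c hc (Or.inl le_rfl)
  have hwd := hcd d hd (Or.inr le_rfl)
  set v : G := ⟨h, hh⟩ * w * ⟨h, hh⟩⁻¹ with hv
  have hvx : ∀ x, (v : ℝ ≃o ℝ) x = h ((w : ℝ ≃o ℝ) (h⁻¹ x)) := fun x => rfl
  have hvfix : ∀ x, (w : ℝ ≃o ℝ) (h⁻¹ x) = h⁻¹ x → (v : ℝ ≃o ℝ) x = x := fun x hx => by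
    rw [hvx, hx, ← RelIso.mul_apply, mul_inv_cancel, RelIso.one_apply]
  have hinv : ∀ t, ∀ x ∈ orbitHull G t, h⁻¹ x ∈ orbitHull G t := fun t x hx =>
    apply_mem_orbitHull (inv_mem hh) hx
  have hvd : ∀ x ∈ orbitHull G s, x ≤ d → (v : ℝ ≃o ℝ) x = x := fun x hx hxd =>
    hvfix x (hcd _ (hinv s x hx) (Or.inl ((OrderIso.inv_apply_lt_iff _).2
      (hxd.trans_lt hdh)).le))
  have hwmem : ∀ t, ∀ x ∈ orbitHull G t, (w : ℝ ≃o ℝ) x ∈ orbitHull G t := fun t x hx =>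
    apply_mem_orbitHull w.2 hx
  have hcomm : ∀ x, (w : ℝ ≃o ℝ) ((v : ℝ ≃o ℝ) x) = (v : ℝ ≃o ℝ) ((w : ℝ ≃o ℝ) x) →
      ((⁅v⁻¹, w⁻¹⁆ : G) : ℝ ≃o ℝ) x = x := by
    intro x hx
    have : (⁅v⁻¹, w⁻¹⁆ : G) = (w * v)⁻¹ * (v * w) := by
      rw [commutatorElement_def]; group
    rw [this]
    change ((w * v : ℝ ≃o ℝ)⁻¹ : ℝ ≃o ℝ) ((v : ℝ ≃o ℝ) ((w : ℝ ≃o ℝ) x)) = x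
    rw [← hx]
    exact RelIso.inv_apply_self (w * v : ℝ ≃o ℝ) x
  refine ⟨⁅v⁻¹, w⁻¹⁆, Subgroup.commutator_mem_commutator (Subgroup.mem_top _)
    (Subgroup.mem_top _), fun h1 => ?_, fun x hx => hcomm x ?_, fun t ht x hx => hcomm x ?_⟩
  · have h2 : Commute v w := by
      have := commutatorElement_eq_one_iff_commute.1 h1
      simpa using this
    obtain ⟨z, ⟨m, hm⟩, n, hn⟩ := IsFreeGroup.exists_zpow_of_commute h2
    have h3 : w ^ m = v ^ n := by rw [← hm, ← hn, ← zpow_mul, ← zpow_mul, mul_comm]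
    have hx₀d : x₀ ≤ d := by
      by_contra! hlt
      exact hwx₀ (hcd x₀ hx₀ (Or.inr hlt.le))
    have h4 := OrderIso.zpow_apply_of_apply_eq (hvd x₀ hx₀ hx₀d) n
    have h5 : ((w : ℝ ≃o ℝ) ^ m) = (v : ℝ ≃o ℝ) ^ n := by
      simpa using congrArg Subtype.val h3
    rw [← h5] at h4
    obtain rfl := OrderIso.eq_zero_of_zpow_apply_eq hwx₀ h4
    have hv1 : v = 1 := by rw [← hm, zpow_zero]
    rw [hv, mul_inv_eq_one, mul_eq_left] at hv1
    exact hw1 hv1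
  · rcases le_total x d with hxd | hxd
    · rw [hvd x hx hxd, hvd _ (hwmem s x hx) (by rw [← hwd, OrderIso.le_iff_le]; exact hxd)]
    · have hvd' : d ≤ (v : ℝ ≃o ℝ) x := by
        rw [← hvd d hd le_rfl, OrderIso.le_iff_le]; exact hxd
      rw [hcd x hx (Or.inr hxd), hcd _ (apply_mem_orbitHull v.2 hx) (Or.inr hvd')]
  · rw [hvfix x (ht _ (hinv t x hx)), ht x hx, hvfix x (ht _ (hinv t x hx))]

theorem isFixed_of_forall_notMem_orbitHull {G : Subgroup (ℝ ≃o ℝ)} {a b : ℝ}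
    (hG : G ≤ dyadicPLOn a b) {S : Finset ℝ} {x : ℝ} (hx : ∀ s ∈ S, x ∉ orbitHull G s)
    {f : ℝ ≃o ℝ} (hf : f ∈ G) (hfS : IsDyadicPLWith S f) : f x = x := by
  have hne : {y | ∃ g ∈ G, g x = y}.Nonempty := ⟨x, 1, one_mem G, rfl⟩
  have hA := bddAbove_orbit hG x
  have hB := bddBelow_orbit hG x
  have hα := apply_sInf_orbit hB hf
  have hβ := apply_sSup_orbit hA hf
  have hαx : sInf {y | ∃ g ∈ G, g x = y} ≤ x := csInf_le hB ⟨1, one_mem G, rfl⟩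
  have hxβ : x ≤ sSup {y | ∃ g ∈ G, g x = y} := le_csSup hA ⟨1, one_mem G, rfl⟩
  rcases hαx.eq_or_lt with h | h
  · rwa [h] at hα
  have hαβ := h.trans_le hxβ
  obtain ⟨p, c, -, hp⟩ := hfS.2 _ _ hαβ fun s hs hsm => by
    obtain ⟨_, ⟨k, hk, rfl⟩, hks⟩ := exists_lt_of_csInf_lt hne hsm.1
    obtain ⟨_, ⟨l, hl, rfl⟩, hsl⟩ := exists_lt_of_lt_csSup hne hsm.2
    exact hx s hs ⟨⟨l⁻¹, inv_mem hl, ((OrderIso.inv_apply_lt_iff _).2 hsl).le⟩,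
      k⁻¹, inv_mem hk, ((OrderIso.lt_inv_apply_iff _).2 hks).le⟩
  have h1 := hp _ ⟨le_rfl, hαβ.le⟩
  have h2 := hp _ ⟨hαβ.le, le_rfl⟩
  rw [hα] at h1
  rw [hβ] at h2
  have h3 : ((2 : ℝ) ^ p - 1) * (sSup {y | ∃ g ∈ G, g x = y} - sInf {y | ∃ g ∈ G, g x = y}) = 0 := by
    linarith
  rcases mul_eq_zero.1 h3 with h4 | h4
  · rw [hp x ⟨hαx, hxβ⟩]
    have h5 : (2 : ℝ) ^ p = 1 := by linarith
    rw [h5] at h1 ⊢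
    linarith
  · linarith

theorem IsDyadicPLWith.mono {S T : Finset ℝ} {f : ℝ ≃o ℝ} (hf : IsDyadicPLWith S f)
    (hST : S ⊆ T) (hT : ∀ t ∈ T, IsDyadic t) : IsDyadicPLWith T f :=
  ⟨hT, fun a b hab h => hf.2 a b hab fun s hs => h s (hST hs)⟩

/-- **Brin–Squier**: a bounded group of piecewise linear homeomorphisms is not free of rank two. -/
theorem not_nonempty_mulEquiv_freeGroup {G : Subgroup (ℝ ≃o ℝ)} {a b : ℝ}
    (hG : G ≤ dyadicPLOn a b) : ¬ Nonempty (G ≃* FreeGroup (Fin 2)) := by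
  rintro ⟨e⟩
  have : IsFreeGroup G := IsFreeGroup.ofMulEquiv e.symm
  choose S hS using fun i : Fin 2 => (hG (e.symm (FreeGroup.of i)).2).1
  classical
  set T := Finset.univ.biUnion S
  have hT : ∀ i, IsDyadicPLWith T (e.symm (FreeGroup.of i) : ℝ ≃o ℝ) := fun i =>
    (hS i).mono (Finset.subset_biUnion_of_mem S (Finset.mem_univ i)) fun t ht => by
      obtain ⟨j, -, hj⟩ := Finset.mem_biUnion.1 ht
      exact (hS j).1 t hj
  have key : ∀ U : Finset ℝ, ∃ w ∈ commutator G, w ≠ 1 ∧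
      ∀ s ∈ U, ∀ x ∈ orbitHull G s, (w : ℝ ≃o ℝ) x = x := by
    intro U
    induction U using Finset.induction_on with
    | empty =>
      refine ⟨⁅e.symm (FreeGroup.of 0), e.symm (FreeGroup.of 1)⁆,
        Subgroup.commutator_mem_commutator (Subgroup.mem_top _) (Subgroup.mem_top _),
        fun h => ?_, by simp⟩
      rw [commutatorElement_eq_one_iff_commute] at h
      have h1 := h.map e
      rw [e.apply_symm_apply, e.apply_symm_apply, FreeGroup.commute_of_iff] at h1
      exact absurd h1 (by decide)
    | insert s U _ ih =>
      obtain ⟨w, hw, hw1, hwU⟩ := ih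
      obtain ⟨v, hv, hv1, hvs, hvw⟩ := exists_commutator_trivial_on_orbitHull hG hw hw1 s
      refine ⟨v, hv, hv1, fun t ht => ?_⟩
      rcases Finset.mem_insert.1 ht with rfl | ht
      · exact hvs
      · exact hvw t (hwU t ht)
  obtain ⟨w, -, hw1, hw⟩ := key T
  refine hw1 (Subtype.ext (RelIso.ext fun x => ?_))
  by_cases hx : ∀ s ∈ T, x ∉ orbitHull G s
  · have hfix : ∀ u : FreeGroup (Fin 2), e.symm u ∈
        (MulAction.stabilizer (ℝ ≃o ℝ) x).comap G.subtype := by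
      intro u
      induction u using FreeGroup.induction_on with
      | C1 => rw [map_one]; exact one_mem _
      | of i => exact isFixed_of_forall_notMem_orbitHull hG hx (e.symm _).2 (hT i)
      | inv_of i h => rw [map_inv]; exact inv_mem h
      | mul u v hu hv => rw [map_mul]; exact mul_mem hu hv
    have := hfix (e w)
    rwa [e.symm_apply_apply] at this
  · push Not at hx
    obtain ⟨s, hs, hxs⟩ := hx
    exact hw s hs x hxs

theorem exists_dyadicPL_move {a b y : ℝ} (hy : y ∈ Ioo a b) (Y : Finset ℝ) :
    ∃ g ∈ dyadicPLOn a b, g y ≠ y ∧ ∀ m ∈ Y, m ≠ y → g m = m := by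
  obtain ⟨d, hd, hd'⟩ := Y.exists_gt_forall_notMem_Ioo y
  obtain ⟨c, hc, hc'⟩ := Y.exists_lt_forall_notMem_Ioo y
  obtain ⟨p, hp, hp1, hp2⟩ := IsDyadic.exists_between (max_lt hy.1 hc)
  obtain ⟨q, hq, hq1, hq2⟩ := IsDyadic.exists_between (lt_min hy.2 hd)
  rw [max_lt_iff] at hp1
  rw [lt_min_iff] at hq2
  obtain ⟨g, hg, hg'⟩ := exists_dyadicPL_lt_apply hp hq (hp2.trans hq1)
  refine ⟨g, dyadicPLOn_mono hp1.1.le hq2.1.le hg, (hg' y ⟨hp2, hq1⟩).ne', fun m hm hmy => ?_⟩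
  refine hg.2 m ?_
  by_contra! h
  rcases hmy.lt_or_gt with h1 | h1
  · exact hc' m hm ⟨hp1.2.trans h.1, h1⟩
  · exact hd' m hm ⟨h1, h.2.trans hq2.2⟩

/-- The value of a word at a family of group elements. -/
def wordProd {α G : Type*} [Group G] (f : α → G) (L : List (α × Bool)) : G :=
  (L.map fun x => cond x.2 (f x.1) (f x.1)⁻¹).prod

theorem wordProd_cons {α G : Type*} [Group G] (f : α → G) (x : α × Bool)
    (L : List (α × Bool)) :
    wordProd f (x :: L) = cond x.2 (f x.1) (f x.1)⁻¹ * wordProd f L := by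
  simp [wordProd]

theorem wordProd_mem {α G : Type*} [Group G] {H : Subgroup G} {f : α → G} (hf : ∀ i, f i ∈ H)
    (L : List (α × Bool)) : wordProd f L ∈ H := by
  refine list_prod_mem fun g hg => ?_
  obtain ⟨⟨i, e⟩, -, rfl⟩ := List.mem_map.1 hg
  cases e
  · exact inv_mem (hf i)
  · exact hf i

theorem mem_Ioo_of_mem_dyadicPLOn {g : ℝ ≃o ℝ} {a b x : ℝ} (hg : g ∈ dyadicPLOn a b)
    (hx : x ∈ Ioo a b) : g x ∈ Ioo a b := by
  rw [← hg.2 a (Or.inl le_rfl), ← hg.2 b (Or.inr le_rfl)]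
  exact ⟨g.strictMono hx.1, g.strictMono hx.2⟩

/-- The suffixes of a reduced word can be made to act with distinct values at a point. -/
theorem exists_injOn_suffixes {α : Type*} {a b x₀ : ℝ} (hx₀ : x₀ ∈ Ioo a b)
    {L : List (α × Bool)} (hL : FreeGroup.IsReduced L) :
    ∃ f : α → ℝ ≃o ℝ, (∀ i, f i ∈ dyadicPLOn a b) ∧
      InjOn (fun M => wordProd f M x₀) {M | M <:+ L} := by
  classical
  induction L with
  | nil =>
    refine ⟨fun _ => 1, fun _ => one_mem _, ?_⟩
    rintro M hM N hN -
    rw [List.suffix_nil.1 hM, List.suffix_nil.1 hN]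
  | cons u L ih =>
    obtain ⟨i, e⟩ := u
    obtain ⟨f, hf, hinj⟩ := ih hL.tail
    suffices h : ∃ f : α → ℝ ≃o ℝ, (∀ i, f i ∈ dyadicPLOn a b) ∧
        InjOn (fun M => wordProd f M x₀) {M | M <:+ L} ∧
        ∀ M, M <:+ L → wordProd f M x₀ ≠ wordProd f ((i, e) :: L) x₀ by
      obtain ⟨f, hf, hinj, hne⟩ := h
      refine ⟨f, hf, fun M hM N hN hMN => ?_⟩
      rcases List.suffix_cons_iff.1 hM with rfl | hM <;>
        rcases List.suffix_cons_iff.1 hN with rfl | hN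
      · rfl
      · exact absurd hMN.symm (hne N hN)
      · exact absurd hMN (hne M hM)
      · exact hinj hM hN hMN
    set l := cond e (f i) (f i)⁻¹ with hl
    set y := wordProd f ((i, e) :: L) x₀ with hy
    have hyl : y = l (wordProd f L x₀) := by rw [hy, wordProd_cons]; rfl
    obtain ⟨g, hg, hgy, hgY⟩ := exists_dyadicPL_move
      (mem_Ioo_of_mem_dyadicPLOn (wordProd_mem hf ((i, e) :: L)) hx₀)
      (L.tails.toFinset.image fun M => wordProd f M x₀)
    rw [← hy] at hgy hgY
    replace hgY : ∀ M, M <:+ L → wordProd f M x₀ ≠ y →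
        g (wordProd f M x₀) = wordProd f M x₀ := fun M hM =>
      hgY _ (Finset.mem_image_of_mem _ (List.mem_toFinset.2 ((List.mem_tails _ _).2 hM)))
    set f' := Function.update f i (cond e (g * f i) (f i * g⁻¹)) with hf'
    have hl' : cond e (f' i) (f' i)⁻¹ = g * l := by
      cases e <;> simp [hf', hl]
    have hl'' : cond (!e) (f' i) (f' i)⁻¹ = l⁻¹ * g⁻¹ := by
      cases e <;> simp [hf', hl]
    have hll : cond (!e) (f i) (f i)⁻¹ = l⁻¹ := by
      cases e <;> simp [hl]
    have heq : ∀ M, M <:+ L → wordProd f' M x₀ = wordProd f M x₀ := by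
      intro M hM
      induction M with
      | nil => rfl
      | cons v M ihM =>
        have hM' : M <:+ L := (List.suffix_cons v M).trans hM
        rw [wordProd_cons, wordProd_cons, RelIso.mul_apply, RelIso.mul_apply, ihM hM']
        have hMv : wordProd f (v :: M) x₀ = cond v.2 (f v.1) (f v.1)⁻¹ (wordProd f M x₀) := by
          rw [wordProd_cons]; rfl
        obtain ⟨j, e'⟩ := v
        by_cases hj : j = i
        · subst hj
          by_cases he : e' = e
          · subst he
            dsimp only at hMv ⊢
            rw [hl', RelIso.mul_apply, ← hl, ← hMv]
            refine hgY _ hM fun h => ?_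
            rw [hMv, hyl, ← hl] at h
            have h1 := hinj hM' (List.suffix_refl L) (l.injective h)
            have h2 := hM.length_le
            rw [h1] at h2
            simp at h2
          · obtain rfl : e' = !e := Bool.eq_not.2 he
            dsimp only at hMv ⊢
            rw [hll] at hMv
            rw [hl'', hll, RelIso.mul_apply]
            congr 1
            have h0 : wordProd f M x₀ ≠ y := fun h => by
              rw [h, hyl, RelIso.inv_apply_self] at hMv
              have h1 := hinj hM (List.suffix_refl L) hMv
              rw [← h1, FreeGroup.isReduced_cons_cons] at hL
              simpa using hL.1
            conv_lhs => rw [← hgY M hM' h0]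
            rw [RelIso.inv_apply_self]
        · dsimp only
          rw [hf', Function.update_of_ne hj]
    refine ⟨f', fun j => ?_, fun M hM N hN hMN => ?_, fun M hM h => ?_⟩
    · by_cases hj : j = i
      · subst hj
        rw [hf', Function.update_self]
        cases e
        · exact mul_mem (hf j) (inv_mem hg)
        · exact mul_mem hg (hf j)
      · rw [hf', Function.update_of_ne hj]
        exact hf j
    · dsimp only at hMN
      rw [heq M hM, heq N hN] at hMN
      exact hinj hM hN hMN
    · rw [heq M hM, wordProd_cons, hl', RelIso.mul_apply, RelIso.mul_apply,
        heq L (List.suffix_refl L), ← hyl] at h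
      have h1 : wordProd f M x₀ ≠ y := fun h1 => hgy (h.symm.trans h1)
      have h2 := hgY M hM h1
      rw [h] at h2
      exact hgy (g.injective h2)

theorem exists_lift_ne_one {α : Type*} {a b : ℝ} (hab : a < b) {w : FreeGroup α} (hw : w ≠ 1) :
    ∃ f : α → dyadicPLOn a b, FreeGroup.lift f w ≠ 1 := by
  classical
  obtain ⟨x₀, hx₀⟩ := exists_between hab
  obtain ⟨f, hf, hinj⟩ := exists_injOn_suffixes (a := a) (b := b) hx₀ w.isReduced_toWord
  refine ⟨fun i => ⟨f i, hf i⟩, fun h => hw ?_⟩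
  have h1 : FreeGroup.lift f = (dyadicPLOn a b).subtype.comp
      (FreeGroup.lift fun i => ⟨f i, hf i⟩) := by ext; simp
  have h2 : wordProd f w.toWord = 1 := by
    rw [← map_one (dyadicPLOn a b).subtype, ← h, ← MonoidHom.comp_apply, ← h1]
    conv_rhs => rw [← FreeGroup.mk_toWord (x := w)]
    rfl
  have h3 := hinj (List.suffix_refl _) (List.nil_suffix (l := w.toWord))
    (by dsimp only; rw [h2]; rfl)
  rwa [FreeGroup.toWord_eq_nil_iff] at h3

theorem apply_mem_Icc_iff {f : ℝ ≃o ℝ} {a b : ℝ} (hf : f ∈ dyadicPLOn a b) (x : ℝ) :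
    x ∈ Icc a b ↔ f x ∈ Icc a b := by
  rw [mem_Icc, mem_Icc, ← f.le_iff_le (x := a), ← f.le_iff_le (x := x),
    hf.2 a (Or.inl le_rfl), hf.2 b (Or.inr le_rfl)]

/-- Restriction to the unit interval. -/
def restrictIcc : dyadicPLOn 0 1 →* Equiv.Perm (Icc (0 : ℝ) 1) where
  toFun f := (f : ℝ ≃o ℝ).toEquiv.subtypeEquiv (apply_mem_Icc_iff f.2)
  map_one' := rfl
  map_mul' _ _ := rfl

theorem restrictIcc_apply (f : dyadicPLOn 0 1) (x : Icc (0 : ℝ) 1) :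
    (restrictIcc f x : ℝ) = (f : ℝ ≃o ℝ) x := rfl

theorem restrictIcc_injective : Function.Injective restrictIcc := by
  intro f g h
  refine Subtype.ext (RelIso.ext fun x => ?_)
  by_cases hx : x ∈ Icc (0 : ℝ) 1
  · rw [← restrictIcc_apply f ⟨x, hx⟩, h, restrictIcc_apply]
  · have hx' : x ≤ 0 ∨ 1 ≤ x := by
      by_contra! h
      exact hx ⟨h.1.le, h.2.le⟩
    rw [f.2.2 x hx', g.2.2 x hx']

theorem isThompsonF_restrictIcc (f : dyadicPLOn 0 1) : IsThompsonF (restrictIcc f) := by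
  refine ⟨((f : ℝ ≃o ℝ).continuous.comp continuous_subtype_val).subtype_mk _, ?_⟩
  obtain ⟨S, hSd, hS⟩ := f.2.1
  set T : Finset ℝ := insert 0 (insert 1 (S.filter (· ∈ Icc (0 : ℝ) 1))) with hT
  have hTI : ∀ s ∈ T, s ∈ Icc (0 : ℝ) 1 := by
    intro s hs
    simp only [hT, Finset.mem_insert, Finset.mem_filter] at hs
    rcases hs with rfl | rfl | hs
    · simp
    · simp
    · exact hs.2
  have hTd : ∀ s ∈ T, IsDyadic s := by
    intro s hs
    simp only [hT, Finset.mem_insert, Finset.mem_filter] at hs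
    rcases hs with rfl | rfl | hs
    exacts [IsDyadic.zero, IsDyadic.one, hSd s hs.1]
  have h0 : (0 : ℝ) ∈ T := by simp [hT]
  have h1 : (1 : ℝ) ∈ T := by simp [hT]
  obtain ⟨k, hk⟩ := Nat.exists_eq_succ_of_ne_zero (Finset.card_ne_zero_of_mem h0)
  have hr : ∀ s ∈ T, ∃ i, T.orderEmbOfFin hk i = s := fun s hs => by
    have : s ∈ Set.range (T.orderEmbOfFin hk) := by
      rw [Finset.range_orderEmbOfFin]; exact hs
    exact this
  have hm := fun i => T.orderEmbOfFin_mem hk i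
  refine ⟨k, T.orderEmbOfFin hk, ?_, ?_, (T.orderEmbOfFin hk).strictMono, fun i => hTd _ (hm i),
    fun i => ?_⟩
  · obtain ⟨j, hj⟩ := hr 0 h0
    refine le_antisymm ?_ (hTI _ (hm 0)).1
    rw [← hj]
    exact (T.orderEmbOfFin hk).monotone (Fin.zero_le j)
  · obtain ⟨j, hj⟩ := hr 1 h1
    refine le_antisymm (hTI _ (hm _)).2 ?_
    rw [← hj]
    exact (T.orderEmbOfFin hk).monotone (Fin.le_last j)
  · obtain ⟨p, c, -, hp⟩ := hS (T.orderEmbOfFin hk i.castSucc) (T.orderEmbOfFin hk i.succ)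
      ((T.orderEmbOfFin hk).strictMono Fin.castSucc_lt_succ) fun s hs hs' => by
        have hsT : s ∈ T := by
          simp only [hT, Finset.mem_insert, Finset.mem_filter]
          exact Or.inr (Or.inr ⟨hs, (hTI _ (hm _)).1.trans hs'.1.le,
            hs'.2.le.trans (hTI _ (hm _)).2⟩)
        obtain ⟨j, rfl⟩ := hr s hsT
        have h2 := (T.orderEmbOfFin hk).lt_iff_lt.1 hs'.1
        have h3 := (T.orderEmbOfFin hk).lt_iff_lt.1 hs'.2
        rw [Fin.lt_def] at h2 h3
        simp at h2 h3
        omega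
    exact ⟨p, c, fun x hx hx' => hp x ⟨hx, hx'⟩⟩

theorem Fin.exists_le_lt_succ {k : ℕ} {t : Fin (k + 1) → ℝ} {a : ℝ} (h0 : t 0 ≤ a)
    (h1 : a < t (Fin.last k)) : ∃ i : Fin k, t i.castSucc ≤ a ∧ a < t i.succ := by
  by_contra! h
  have key : ∀ j : Fin (k + 1), t j ≤ a := fun j => by
    induction j using Fin.induction with
    | zero => exact h0
    | succ i ih => exact h i ih
  exact (key _).not_gt h1

theorem exists_orderIso_extension {f : Equiv.Perm (Icc (0 : ℝ) 1)} (hf : StrictMono f) :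
    ∃ g : ℝ ≃o ℝ, (∀ x : Icc (0 : ℝ) 1, g x = f x) ∧ ∀ x, x ≤ 0 ∨ 1 ≤ x → g x = x := by
  classical
  have h0 : f ⟨0, by simp⟩ = ⟨0, by simp⟩ := by
    obtain ⟨y, hy⟩ := f.surjective ⟨0, by simp⟩
    have h : f ⟨0, by simp⟩ ≤ f y := hf.monotone y.2.1
    rw [hy] at h
    exact le_antisymm h (f _).2.1
  have h1 : f ⟨1, by simp⟩ = ⟨1, by simp⟩ := by
    obtain ⟨y, hy⟩ := f.surjective ⟨1, by simp⟩
    have h : f y ≤ f ⟨1, by simp⟩ := hf.monotone y.2.2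
    rw [hy] at h
    exact le_antisymm (f _).2.2 h
  set φ : ℝ → ℝ := fun x => if h : x ∈ Icc (0 : ℝ) 1 then f ⟨x, h⟩ else x with hφ
  have hin : ∀ x : Icc (0 : ℝ) 1, φ x = f x := fun x => dif_pos x.2
  have hout : ∀ x, x ≤ 0 ∨ 1 ≤ x → φ x = x := by
    intro x hx
    by_cases h : x ∈ Icc (0 : ℝ) 1
    · rcases hx with hx | hx
      · obtain rfl := le_antisymm hx h.1
        rw [hin ⟨0, h⟩, h0]
      · obtain rfl := le_antisymm hx h.2
        rw [hin ⟨1, h⟩, h1]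
    · exact dif_neg h
  have hmono : StrictMono φ := by
    have hA : StrictMonoOn φ (Iic 0) := fun x hx y hy hxy => by
      rwa [hout x (Or.inl hx), hout y (Or.inl hy)]
    have hB : StrictMonoOn φ (Icc 0 1) := fun x hx y hy hxy => by
      rw [hin ⟨x, hx⟩, hin ⟨y, hy⟩]
      exact hf hxy
    have hC : StrictMonoOn φ (Ici 1) := fun x hx y hy hxy => by
      rwa [hout x (Or.inr hx), hout y (Or.inr hy)]
    have hAB := hA.union hB isGreatest_Iic (isLeast_Icc zero_le_one)
    rw [Iic_union_Icc_eq_Iic zero_le_one] at hAB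
    have hABC := hAB.union hC isGreatest_Iic isLeast_Ici
    rwa [Iic_union_Ici, strictMonoOn_univ] at hABC
  have hsurj : Function.Surjective φ := by
    intro y
    by_cases h : y ∈ Icc (0 : ℝ) 1
    · obtain ⟨x, hx⟩ := f.surjective ⟨y, h⟩
      exact ⟨x, by rw [hin, hx]⟩
    · exact ⟨y, dif_neg h⟩
  exact ⟨hmono.orderIsoOfSurjective φ hsurj, hin, hout⟩

theorem strictMono_of_isThompsonF {f : Equiv.Perm (Icc (0 : ℝ) 1)} (hf : IsThompsonF f) :
    StrictMono f := by
  obtain ⟨-, k, t, t0, t1, tm, -, hp⟩ := hf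
  have key : ∀ j : Fin (k + 1), StrictMonoOn f {x | (x : ℝ) ≤ t j} := by
    intro j
    induction j using Fin.induction with
    | zero =>
      intro x hx y hy hxy
      have : (x : ℝ) < y := hxy
      have h0 : (y : ℝ) ≤ t 0 := hy
      linarith [x.2.1]
    | succ i ih =>
      have hti : t i.castSucc ∈ Icc (0 : ℝ) 1 :=
        ⟨t0 ▸ tm.monotone (Fin.zero_le _), t1 ▸ tm.monotone (Fin.le_last _)⟩
      have hlt : t i.castSucc < t i.succ := tm Fin.castSucc_lt_succ
      obtain ⟨p, c, h⟩ := hp i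
      have h2 : StrictMonoOn f {x | t i.castSucc ≤ (x : ℝ) ∧ (x : ℝ) ≤ t i.succ} := by
        intro x hx y hy hxy
        change (f x : ℝ) < f y
        rw [h x hx.1 hx.2, h y hy.1 hy.2]
        have : (x : ℝ) < y := hxy
        gcongr
      have h3 := ih.union h2 (c := ⟨t i.castSucc, hti⟩) ⟨le_refl (t i.castSucc), fun x hx => hx⟩
        ⟨⟨le_refl (t i.castSucc), hlt.le⟩, fun x hx => hx.1⟩
      refine h3.mono fun x hx => ?_
      rcases le_total (x : ℝ) (t i.castSucc) with h4 | h4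
      · exact Or.inl h4
      · exact Or.inr ⟨h4, hx⟩
  intro x y hxy
  exact key (Fin.last k) (x.2.2.trans_eq t1.symm) (y.2.2.trans_eq t1.symm) hxy

theorem exists_restrictIcc_eq {f : Equiv.Perm (Icc (0 : ℝ) 1)} (hf : IsThompsonF f) :
    ∃ g, restrictIcc g = f := by
  obtain ⟨g, hg, hg'⟩ := exists_orderIso_extension (strictMono_of_isThompsonF hf)
  obtain ⟨-, k, t, t0, t1, tm, td, hp⟩ := hf
  have ht : ∀ i, t i ∈ Icc (0 : ℝ) 1 := fun i =>
    ⟨t0 ▸ tm.monotone (Fin.zero_le _), t1 ▸ tm.monotone (Fin.le_last _)⟩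
  have hgp : ∀ i : Fin k, ∃ (p : ℤ) (c : ℝ), ∀ x ∈ Icc (t i.castSucc) (t i.succ),
      g x = 2 ^ p * x + c := fun i => by
    obtain ⟨p, c, h⟩ := hp i
    exact ⟨p, c, fun x hx => (hg ⟨x, (ht _).1.trans hx.1, hx.2.trans (ht _).2⟩).trans
      (h _ hx.1 hx.2)⟩
  have hgt : ∀ i, IsDyadic (g (t i)) := fun i => by
    induction i using Fin.induction with
    | zero => rw [t0, hg' 0 (Or.inl le_rfl)]; exact IsDyadic.zero
    | succ i ih =>
      obtain ⟨p, c, h⟩ := hgp i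
      have hlt := (tm (Fin.castSucc_lt_succ (i := i))).le
      have : g (t i.succ) = g (t i.castSucc) + 2 ^ p * (t i.succ - t i.castSucc) := by
        rw [h _ ⟨le_rfl, hlt⟩, h _ ⟨hlt, le_rfl⟩]; ring
      rw [this]
      exact ih.add ((IsDyadic.two_zpow p).mul ((td _).sub (td _)))
  have hgd : g ∈ dyadicPLOn 0 1 := by
    refine ⟨⟨Finset.univ.image t, fun s hs => ?_, fun a b hab hS => ?_⟩, hg'⟩
    · obtain ⟨i, -, rfl⟩ := Finset.mem_image.1 hs
      exact td i
    · replace hS : ∀ i, t i ∉ Ioo a b := fun i =>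
        hS _ (Finset.mem_image_of_mem _ (Finset.mem_univ i))
      have hout : (b ≤ 0 ∨ 1 ≤ a) → ∃ (p : ℤ) (c : ℝ), IsDyadic c ∧
          ∀ x ∈ Icc a b, g x = 2 ^ p * x + c := fun h => ⟨0, 0, IsDyadic.zero, fun x hx => by
        rw [hg' x (h.imp hx.2.trans fun h => h.trans hx.1)]; simp⟩
      by_cases h : b ≤ 0 ∨ 1 ≤ a
      · exact hout h
      push Not at h
      have ha : t 0 ≤ a := not_lt.1 fun h' => hS 0 ⟨h', t0 ▸ h.1⟩
      obtain ⟨i, hi, hi'⟩ := Fin.exists_le_lt_succ ha (t1 ▸ h.2)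
      have hb : b ≤ t i.succ := not_lt.1 fun h' => hS _ ⟨hi', h'⟩
      obtain ⟨p, c, hpc⟩ := hgp i
      refine ⟨p, c, ?_, fun x hx => hpc x ⟨hi.trans hx.1, hx.2.trans hb⟩⟩
      have : c = g (t i.castSucc) - 2 ^ p * t i.castSucc := by
        rw [hpc _ ⟨le_rfl, hi.trans hi'.le⟩]; ring
      rw [this]
      exact (hgt _).sub ((IsDyadic.two_zpow p).mul (td _))
  exact ⟨⟨g, hgd⟩, Equiv.ext fun x => Subtype.ext (hg x)⟩

theorem isSimpleGroup_commutator_dyadicPLOn : IsSimpleGroup (commutator (dyadicPLOn 0 1)) := by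
  have := isSimpleGroup_dyadicPLInner
  exact (((commutator (dyadicPLOn 0 1)).equivMapOfInjective _
    (Subgroup.subtype_injective _)).trans
      (MulEquiv.subgroupCongr map_commutator_dyadicPLOn)).isSimpleGroup

theorem MulEquiv.isSimpleGroup_commutator {G H : Type*} [Group G] [Group H] (e : G ≃* H)
    [IsSimpleGroup (commutator G)] : IsSimpleGroup (commutator H) := by
  have h : (commutator G).map e.toMonoidHom = commutator H := by
    rw [commutator_def, commutator_def, Subgroup.map_commutator,
      Subgroup.map_top_of_surjective _ e.surjective]
  exact ((e.subgroupMap (commutator G)).trans (MulEquiv.subgroupCongr h)).symm.isSimpleGroup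

/-- Thompson's group `F` is a group under composition; its abelianization is `ℤ × ℤ`;
its commutator subgroup is simple; it contains no free subgroup of rank 2; and it
satisfies no group law. -/
theorem thompson_group_F :
    ∃ H : Subgroup (Equiv.Perm ↥(Set.Icc (0 : ℝ) 1)),
      ((H : Set (Equiv.Perm ↥(Set.Icc (0 : ℝ) 1))) = {f | IsThompsonF f}) ∧
      Nonempty (Abelianization ↥H ≃* Multiplicative (ℤ × ℤ)) ∧
      IsSimpleGroup ↥(commutator ↥H) ∧
      (∀ K : Subgroup ↥H, ¬Nonempty (↥K ≃* FreeGroup (Fin 2))) ∧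
      (∀ (n : ℕ) (w : FreeGroup (Fin n)), w ≠ 1 →
        ∃ f : Fin n → ↥H, FreeGroup.lift f w ≠ 1) := by
  have e : dyadicPLOn 0 1 ≃* restrictIcc.range := MonoidHom.ofInjective restrictIcc_injective
  refine ⟨restrictIcc.range, ?_, ?_, ?_, ?_, ?_⟩
  · ext f
    refine ⟨?_, exists_restrictIcc_eq⟩
    rintro ⟨g, rfl⟩
    exact isThompsonF_restrictIcc g
  · exact nonempty_abelianization_dyadicPLOn.map e.symm.abelianizationCongr.trans
  · have := isSimpleGroup_commutator_dyadicPLOn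
    exact e.isSimpleGroup_commutator
  · rintro K ⟨φ⟩
    let ι := (dyadicPLOn 0 1).subtype.comp e.symm.toMonoidHom
    have hι : Function.Injective ι := (Subgroup.subtype_injective _).comp e.symm.injective
    refine not_nonempty_mulEquiv_freeGroup (G := K.map ι) (a := 0) (b := 1) ?_
      ⟨(K.equivMapOfInjective ι hι).symm.trans φ⟩
    rintro _ ⟨x, -, rfl⟩
    exact (e.symm x).2
  · intro n w hw
    obtain ⟨f, hf⟩ := exists_lift_ne_one (a := 0) (b := 1) zero_lt_one hw
    refine ⟨e ∘ f, fun h => hf (e.injective ?_)⟩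
    have h1 : FreeGroup.lift (e ∘ f) = e.toMonoidHom.comp (FreeGroup.lift f) := by ext; simp
    rw [h1] at h
    rw [map_one]
    exact h
end

section
/- For n ≥ 0 let a_n and s_n be the permutations of the set {0,1,2}^n of ternary words of length n defined recursively by a_n(xv) = ((x+1) mod 3)·v, and s_n(0v) = 0·a_{n−1}(v), s_n(1v) = 1·v, s_n(2v) = 2·s_{n−1}(v), with a₀ = s₀ = id; identify a_n and s_n with the corresponding 3^n × 3^n real permutation matrices, and set A_n = a_n + a_nᵀ, S_n = s_n + s_nᵀ, and Q_n(λ,μ) = S_n + λ·A_n − μ·I for real λ, μ. Then det Q₀(λ,μ) = 2 + 2λ − μ; det Q₁(λ,μ) = (2 + 2λ − μ)(2 − λ − μ)²; and for every n ≥ 2 and all real λ, μ with αγ ≠ 0, where α = 2 − μ + λ, β = 2 − μ − λ, γ = μ² − λ² − μ − 2, δ = μ² − λ² − 2μ − λ, one has det Q_n(λ,μ) = (αβγ²)^{3^{n−2}} · det Q_{n−1}(λ²β/(αγ), μ + 2λ²δ/(αγ)). -/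
open Matrix

/-- The level-`n` action of the generator `a` of the Fabrykowski–Gupta group on ternary
words of length `n`: `a_n(xv) = ((x+1) mod 3)·v`, `a₀ = id`. -/
def fgA : (n : ℕ) → (Fin n → Fin 3) → (Fin n → Fin 3)
  | 0, v => v
  | _ + 1, v => Fin.cons (v 0 + 1) (Fin.tail v)

/-- The level-`n` action of the generator `s` of the Fabrykowski–Gupta group:
`s_n(0v) = 0·a_{n−1}(v)`, `s_n(1v) = 1·v`, `s_n(2v) = 2·s_{n−1}(v)`, `s₀ = id`. -/
def fgS : (n : ℕ) → (Fin n → Fin 3) → (Fin n → Fin 3)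
  | 0, v => v
  | n + 1, v =>
    if v 0 = 0 then Fin.cons 0 (fgA n (Fin.tail v))
    else if v 0 = 2 then Fin.cons 2 (fgS n (Fin.tail v))
    else v

/-- The real permutation matrix of a map `f` of a finite set. -/
def permMat {I : Type*} [Fintype I] [DecidableEq I] (f : I → I) : Matrix I I ℝ :=
  Matrix.of fun i j => if f j = i then 1 else 0

/-- `A_n = a_n + a_nᵀ`. -/
noncomputable def fgAmat (n : ℕ) : Matrix (Fin n → Fin 3) (Fin n → Fin 3) ℝ :=
  permMat (fgA n) + (permMat (fgA n))ᵀ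

/-- `S_n = s_n + s_nᵀ`. -/
noncomputable def fgSmat (n : ℕ) : Matrix (Fin n → Fin 3) (Fin n → Fin 3) ℝ :=
  permMat (fgS n) + (permMat (fgS n))ᵀ

/-- `Q_n(λ,μ) = S_n + λ·A_n − μ·I`. -/
noncomputable def fgQ (n : ℕ) (lam mu : ℝ) : Matrix (Fin n → Fin 3) (Fin n → Fin 3) ℝ :=
  fgSmat n + lam • fgAmat n - mu • (1 : Matrix (Fin n → Fin 3) (Fin n → Fin 3) ℝ)

/-- Adjoining a first letter, as a bijection from three copies of the words of length `n`
onto the words of length `n + 1`. -/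
noncomputable def consSumEquiv (n : ℕ) :
    ((Fin n → Fin 3) ⊕ (Fin n → Fin 3)) ⊕ (Fin n → Fin 3) ≃ (Fin (n + 1) → Fin 3) :=
  Equiv.ofBijective
    (Sum.elim (Sum.elim (fun v => Fin.cons 0 v) fun v => Fin.cons 1 v) fun v => Fin.cons 2 v) <| by
  constructor
  · rintro ((u | u) | u) ((v | v) | v) <;> simp [Fin.cons_inj]
  · intro w
    obtain ⟨x, v, rfl⟩ : ∃ (x : Fin 3) (v : Fin n → Fin 3), w = Fin.cons x v :=
      ⟨w 0, Fin.tail w, (Fin.cons_self_tail w).symm⟩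
    fin_cases x
    · exact ⟨.inl (.inl v), rfl⟩
    · exact ⟨.inl (.inr v), rfl⟩
    · exact ⟨.inr v, rfl⟩

@[simp]
theorem consSumEquiv_inl_inl (n : ℕ) (v : Fin n → Fin 3) :
    consSumEquiv n (.inl (.inl v)) = Fin.cons 0 v := rfl

@[simp]
theorem consSumEquiv_inl_inr (n : ℕ) (v : Fin n → Fin 3) :
    consSumEquiv n (.inl (.inr v)) = Fin.cons 1 v := rfl

@[simp]
theorem consSumEquiv_inr (n : ℕ) (v : Fin n → Fin 3) :
    consSumEquiv n (.inr v) = Fin.cons 2 v := rfl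

/-- A nonempty word as a pair of its first letter and its tail. -/
def consProdEquiv (n : ℕ) : Fin 3 × (Fin n → Fin 3) ≃ (Fin (n + 1) → Fin 3) :=
  Fin.consEquiv fun _ => Fin 3

@[simp]
theorem consProdEquiv_apply (n : ℕ) (x : Fin 3) (v : Fin n → Fin 3) :
    consProdEquiv n (x, v) = Fin.cons x v := rfl

theorem fgAmat_succ_cons (n : ℕ) (x y : Fin 3) (u v : Fin n → Fin 3) :
    fgAmat (n + 1) (Fin.cons x u) (Fin.cons y v) = if u = v ∧ x ≠ y then 1 else 0 := by
  by_cases huv : u = v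
  · subst huv
    fin_cases x <;> fin_cases y <;> simp [fgAmat, permMat, fgA, Fin.cons_inj]
  · simp [fgAmat, permMat, fgA, Fin.cons_inj, huv, Ne.symm huv]

/-- The adjacency matrix of the triangle. -/
def triangleMat : Matrix (Fin 3) (Fin 3) ℝ := of fun i j => if i = j then 0 else 1

theorem triangleMat_mul_self : triangleMat * triangleMat = triangleMat + (2 : ℝ) • 1 := by
  ext i j
  fin_cases i <;> fin_cases j <;>
    simp [triangleMat, Matrix.mul_apply, Fin.sum_univ_succ] <;> norm_num

theorem smul_fgAmat_succ_add_submatrix (n : ℕ) (p q : ℝ) :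
    (p • fgAmat (n + 1) + q • (1 : Matrix (Fin (n + 1) → Fin 3) (Fin (n + 1) → Fin 3) ℝ)).submatrix
        (consProdEquiv n) (consProdEquiv n) =
      blockDiagonal fun _ : Fin n → Fin 3 => p • triangleMat + q • 1 := by
  ext ⟨x, u⟩ ⟨y, v⟩
  by_cases huv : u = v <;> by_cases hxy : x = y <;>
    simp [fgAmat_succ_cons, blockDiagonal_apply, triangleMat, Fin.cons_inj, huv, hxy]

theorem fgAmat_succ_mul_self (n : ℕ) :
    fgAmat (n + 1) * fgAmat (n + 1) =
      fgAmat (n + 1) + (2 : ℝ) • (1 : Matrix (Fin (n + 1) → Fin 3) (Fin (n + 1) → Fin 3) ℝ) := by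
  have h := smul_fgAmat_succ_add_submatrix n 1 0
  have h2 := smul_fgAmat_succ_add_submatrix n 1 2
  simp only [one_smul, zero_smul, add_zero] at h h2
  apply (reindex (consProdEquiv n).symm (consProdEquiv n).symm).injective
  simp only [reindex_apply, Equiv.symm_symm]
  rw [h2, ← triangleMat_mul_self, blockDiagonal_mul, ← h, submatrix_mul_equiv]

theorem det_smul_fgAmat_succ_add (n : ℕ) (p q : ℝ) :
    (p • fgAmat (n + 1) + q • (1 : Matrix (Fin (n + 1) → Fin 3) (Fin (n + 1) → Fin 3) ℝ)).det =
      ((2 * p + q) * (q - p) ^ 2) ^ 3 ^ n := by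
  rw [← det_submatrix_equiv_self (consProdEquiv n), smul_fgAmat_succ_add_submatrix,
    det_blockDiagonal, Finset.prod_const, Finset.card_univ]
  congr 1
  · simp [det_fin_three, triangleMat]
    ring
  · simp

theorem det_fromBlocks_scalar {ι : Type*} [Fintype ι] [DecidableEq ι] (P : Matrix ι ι ℝ)
    (l d : ℝ) :
    (fromBlocks P (l • (1 : Matrix ι ι ℝ)) (l • (1 : Matrix ι ι ℝ)) (d • (1 : Matrix ι ι ℝ))).det =
      (d • P - l ^ 2 • (1 : Matrix ι ι ℝ)).det := by
  suffices (fun d : ℝ => (fromBlocks P (l • (1 : Matrix ι ι ℝ)) (l • (1 : Matrix ι ι ℝ))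
      (d • (1 : Matrix ι ι ℝ))).det) =
      fun d : ℝ => (d • P - l ^ 2 • (1 : Matrix ι ι ℝ)).det from congrFun this d
  refine Continuous.ext_on (dense_compl_singleton (0 : ℝ)) ?_ ?_ ?_
  · exact (Continuous.matrix_fromBlocks (by fun_prop) (by fun_prop) (by fun_prop)
      (by fun_prop)).matrix_det
  · exact Continuous.matrix_det (by fun_prop)
  · intro d hd
    have hd : d ^ Fintype.card ι ≠ 0 := pow_ne_zero _ hd
    have h : fromBlocks P (l • (1 : Matrix ι ι ℝ)) (l • (1 : Matrix ι ι ℝ)) (d • (1 : Matrix ι ι ℝ)) *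
          fromBlocks (d • (1 : Matrix ι ι ℝ)) 0 (-(l • (1 : Matrix ι ι ℝ))) 1 =
        fromBlocks (d • P - l ^ 2 • (1 : Matrix ι ι ℝ)) (l • (1 : Matrix ι ι ℝ)) 0
          (d • (1 : Matrix ι ι ℝ)) := by
      rw [fromBlocks_multiply]
      congr 1 <;> simp [smul_smul, sub_eq_add_neg, pow_two, mul_comm]
    have h' := congrArg det h
    rw [det_mul, det_fromBlocks_zero₁₂, det_fromBlocks_zero₂₁] at h'
    simp only [det_smul, det_one, mul_one] at h'
    exact mul_right_cancel₀ hd h'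

theorem det_fromBlocks_of_mul_eq {ι κ : Type*} [Fintype ι] [DecidableEq ι] [Fintype κ]
    [DecidableEq κ] {M : Matrix ι ι ℝ} {X B : Matrix ι κ ℝ} (h : M * X = B) (C : Matrix κ ι ℝ)
    (D : Matrix κ κ ℝ) : (fromBlocks M B C D).det = M.det * (D - C * X).det := by
  have : fromBlocks M B C D = fromBlocks M 0 C (D - C * X) * fromBlocks 1 X 0 1 := by
    rw [fromBlocks_multiply]
    simp [h]
  rw [this, det_mul, det_fromBlocks_zero₁₂, det_fromBlocks_zero₂₁]
  simp

theorem fgSmat_succ_cons (n : ℕ) (x y : Fin 3) (u v : Fin n → Fin 3) :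
    fgSmat (n + 1) (Fin.cons x u) (Fin.cons y v) =
      if x = y then
        (if x = 0 then fgAmat n else if x = 1 then (2 : ℝ) • 1 else fgSmat n) u v
      else 0 := by
  fin_cases x <;> fin_cases y <;>
    simp [fgSmat, fgAmat, permMat, fgS, Fin.cons_inj, Matrix.one_apply]
  by_cases huv : u = v
  · simp [huv]; norm_num
  · simp [huv, Ne.symm huv]

theorem fgQ_succ_submatrix (n : ℕ) (lam mu : ℝ) :
    (fgQ (n + 1) lam mu).submatrix (consSumEquiv n) (consSumEquiv n) =
      fromBlocks
        (fromBlocks (fgAmat n - mu • 1) (lam • 1) (lam • 1) ((2 - mu) • 1))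
        (fromRows (lam • 1) (lam • 1)) (fromCols (lam • 1) (lam • 1)) (fgSmat n - mu • 1) := by
  ext ((u | u) | u) ((v | v) | v) <;>
    simp [fgQ, fgAmat_succ_cons, fgSmat_succ_cons, Matrix.one_apply, Fin.cons_inj]
  split_ifs <;> ring

theorem fromBlocks_mul_fromRows_of_mul_self {ι : Type*} [Fintype ι] [DecidableEq ι]
    {A : Matrix ι ι ℝ} (hA : A * A = A + (2 : ℝ) • (1 : Matrix ι ι ℝ)) {lam mu k : ℝ}
    (hk : k * ((2 - mu + lam) * (mu ^ 2 - lam ^ 2 - mu - 2)) = 1) :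
    fromBlocks (A - mu • (1 : Matrix ι ι ℝ)) (lam • (1 : Matrix ι ι ℝ)) (lam • (1 : Matrix ι ι ℝ))
        ((2 - mu) • (1 : Matrix ι ι ℝ)) *
      fromRows
        ((lam * k) • ((mu ^ 2 - lam ^ 2 - 3 * mu + 2) • (1 : Matrix ι ι ℝ) + (mu - 2) • A))
        ((lam * k) • ((mu ^ 2 - lam ^ 2 - mu - 2 - 2 * lam) • (1 : Matrix ι ι ℝ) + lam • A)) =
      fromRows (lam • (1 : Matrix ι ι ℝ)) (lam • (1 : Matrix ι ι ℝ)) := by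
  rw [fromBlocks_mul_fromRows]
  congr 1 <;>
    simp only [sub_mul, smul_mul_assoc, mul_smul_comm, one_mul, mul_one, mul_add, hA] <;>
    match_scalars
  · ring
  · linear_combination lam * hk
  · linear_combination lam * hk
  · ring

theorem det_fgQ_succ_succ (n : ℕ) (lam mu : ℝ)
    (h : (2 - mu + lam) * (mu ^ 2 - lam ^ 2 - mu - 2) ≠ 0) :
    (fgQ (n + 2) lam mu).det =
      ((2 - mu + lam) * (2 - mu - lam) * (mu ^ 2 - lam ^ 2 - mu - 2) ^ 2) ^ 3 ^ n *
      (fgQ (n + 1)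
        (lam ^ 2 * (2 - mu - lam) / ((2 - mu + lam) * (mu ^ 2 - lam ^ 2 - mu - 2)))
        (mu + 2 * lam ^ 2 * (mu ^ 2 - lam ^ 2 - 2 * mu - lam) /
          ((2 - mu + lam) * (mu ^ 2 - lam ^ 2 - mu - 2)))).det := by
  have hA := fgAmat_succ_mul_self n
  have hdet := det_smul_fgAmat_succ_add n (2 - mu) (-(2 - mu) * mu - lam ^ 2)
  have hQ := fgQ_succ_submatrix (n + 1) lam mu
  rw [← det_submatrix_equiv_self (consSumEquiv (n + 1)), hQ]
  simp only [fgQ]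
  generalize fgAmat (n + 1) = A at *
  generalize fgSmat (n + 1) = S at *
  obtain ⟨k, hk⟩ : ∃ k : ℝ, k * ((2 - mu + lam) * (mu ^ 2 - lam ^ 2 - mu - 2)) = 1 :=
    ⟨_, inv_mul_cancel₀ h⟩
  have hk' : ((2 - mu + lam) * (mu ^ 2 - lam ^ 2 - mu - 2))⁻¹ = k :=
    (eq_inv_of_mul_eq_one_left hk).symm
  simp only [div_eq_mul_inv, hk']
  have hX := fromBlocks_mul_fromRows_of_mul_self hA hk
  rw [det_fromBlocks_of_mul_eq hX, det_fromBlocks_scalar]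
  congr 1
  · convert hdet using 2
    · module
    · ring
  · congr 1
    rw [fromCols_mul_fromRows]
    simp only [smul_mul_assoc, one_mul]
    match_scalars
    · ring
    · ring
    · ring

/-- The renormalization recursion for the spectral problem of the Fabrykowski–Gupta
group: `det Q₀ = 2+2λ−μ`, `det Q₁ = (2+2λ−μ)(2−λ−μ)²`, and for `n ≥ 2`, whenever
`αγ ≠ 0` (with `α = 2−μ+λ`, `β = 2−μ−λ`, `γ = μ²−λ²−μ−2`, `δ = μ²−λ²−2μ−λ`),
`det Q_n(λ,μ) = (αβγ²)^(3^(n−2)) · det Q_{n−1}(λ²β/(αγ), μ + 2λ²δ/(αγ))`. -/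
theorem fabrykowski_gupta_det_recursion :
    (∀ lam mu : ℝ, (fgQ 0 lam mu).det = 2 + 2 * lam - mu) ∧
    (∀ lam mu : ℝ, (fgQ 1 lam mu).det = (2 + 2 * lam - mu) * (2 - lam - mu) ^ 2) ∧
    (∀ n : ℕ, 2 ≤ n → ∀ lam mu : ℝ,
      (2 - mu + lam) * (mu ^ 2 - lam ^ 2 - mu - 2) ≠ 0 →
      (fgQ n lam mu).det =
        ((2 - mu + lam) * (2 - mu - lam) * (mu ^ 2 - lam ^ 2 - mu - 2) ^ 2) ^ 3 ^ (n - 2) *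
        (fgQ (n - 1)
          (lam ^ 2 * (2 - mu - lam) / ((2 - mu + lam) * (mu ^ 2 - lam ^ 2 - mu - 2)))
          (mu + 2 * lam ^ 2 * (mu ^ 2 - lam ^ 2 - 2 * mu - lam) /
            ((2 - mu + lam) * (mu ^ 2 - lam ^ 2 - mu - 2)))).det) := by
  refine ⟨fun lam mu => ?_, fun lam mu => ?_, fun n hn lam mu h => ?_⟩
  · simp [fgQ, fgSmat, fgAmat, permMat, fgA, fgS, det_unique]
    ring
  · have hS : fgSmat 1 = (2 : ℝ) • 1 := by
      ext w z
      rw [← Fin.cons_self_tail w, ← Fin.cons_self_tail z, fgSmat_succ_cons]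
      generalize w 0 = x
      generalize z 0 = y
      fin_cases x <;> fin_cases y <;>
        simp [fgAmat, fgSmat, permMat, fgA, fgS, Fin.cons_inj,
          Subsingleton.elim (Fin.tail w) (Fin.tail z)] <;> norm_num
    have hQ : fgQ 1 lam mu = lam • fgAmat (0 + 1) + (2 - mu) • 1 := by
      rw [fgQ, hS]
      module
    rw [hQ, det_smul_fgAmat_succ_add]
    ring
  · obtain ⟨m, rfl⟩ : ∃ m, n = m + 2 := ⟨n - 2, by omega⟩
    exact det_fgQ_succ_succ m lam mu h
end

section
/- For k ≥ 0 let a_k and b_k be the permutations of the set {0,1}^k of binary words of length k defined recursively by a_k(0v) = 1·b_{k−1}(v), a_k(1v) = 0·v, b_k(0v) = 0·a_{k−1}(v), b_k(1v) = 1·v, with a₀ = b₀ = id; identify them with 2^k × 2^k real permutation matrices π_k(a), π_k(b), and for real λ, λ₁, λ₂ set Φ_k(λ; λ₁, λ₂) = det(λ·I + λ₁(π_k(a) + π_k(a)ᵀ) + λ₂(π_k(b) + π_k(b)ᵀ)). Then for every k ≥ 0 and all real λ, λ₁, λ₂, writing Λ = λ + 2λ₂, one has Φ_{k+1}(λ;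 λ₁, λ₂) = Φ_k(Λλ − 2λ₁²; Λλ₂, −λ₁²). -/
open Matrix

/-- The pair `(a_k, b_k)` of level-`k` actions of the generators of `IMG(z²−1)` on binary
words of length `k`: `a_k(0v) = 1·b_{k−1}(v)`, `a_k(1v) = 0·v`, `b_k(0v) = 0·a_{k−1}(v)`,
`b_k(1v) = 1·v`, with `a₀ = b₀ = id`. -/
def imgPair : (k : ℕ) → ((Fin k → Fin 2) → (Fin k → Fin 2)) × ((Fin k → Fin 2) → (Fin k → Fin 2))
  | 0 => (id, id)
  | k + 1 =>
    (fun v =>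
      if v 0 = 0 then Fin.cons 1 ((imgPair k).2 (Fin.tail v))
      else Fin.cons 0 (Fin.tail v),
     fun v =>
      if v 0 = 0 then Fin.cons 0 ((imgPair k).1 (Fin.tail v))
      else v)

/-- `Φ_k(λ; λ₁, λ₂) = det(λ·I + λ₁(π_k(a) + π_k(a)ᵀ) + λ₂(π_k(b) + π_k(b)ᵀ))`. -/
noncomputable def imgPhi (k : ℕ) (lam l1 l2 : ℝ) : ℝ :=
  (lam • (1 : Matrix (Fin k → Fin 2) (Fin k → Fin 2) ℝ) +
    l1 • (permMat (imgPair k).1 + (permMat (imgPair k).1)ᵀ) +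
    l2 • (permMat (imgPair k).2 + (permMat (imgPair k).2)ᵀ)).det

/-- The identity `det [[A, B], [C, t]] = det (t A - B C)` for a scalar lower right block. -/
theorem det_fromBlocks_smul_one {n : Type*} [Fintype n] [DecidableEq n]
    (A B C : Matrix n n ℝ) (t : ℝ) :
    (fromBlocks A B C (t • (1 : Matrix n n ℝ))).det = (t • A - B * C).det := by
  suffices h : (fun t : ℝ => (fromBlocks A B C (t • (1 : Matrix n n ℝ))).det) =
      fun t : ℝ => (t • A - B * C).det from congrFun h t
  refine Continuous.ext_on (dense_compl_singleton (0 : ℝ)) ?_ ?_ fun t ht => ?_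
  · exact (Continuous.matrix_fromBlocks continuous_const continuous_const continuous_const
      (continuous_id.smul continuous_const)).matrix_det
  · exact ((continuous_id.smul continuous_const).sub continuous_const).matrix_det
  · have ht : t ≠ 0 := ht
    have hmul : fromBlocks A B C (t • (1 : Matrix n n ℝ)) *
        fromBlocks (t • (1 : Matrix n n ℝ)) 0 (-C) 1 =
        fromBlocks (t • A - B * C) B 0 (t • (1 : Matrix n n ℝ)) := by
      simp [fromBlocks_multiply, sub_eq_add_neg]
    have hdet := congrArg det hmul
    rw [det_mul, det_fromBlocks_zero₁₂, det_fromBlocks_zero₂₁, det_one, mul_one] at hdet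
    refine mul_right_cancel₀ ?_ hdet
    simp [ht]

theorem permMat_transpose_mul_self {I : Type*} [Fintype I] [DecidableEq I] {f : I → I}
    (hf : Function.Injective f) : (permMat f)ᵀ * permMat f = 1 := by
  ext i j
  simp [permMat, mul_apply, one_apply, hf.eq_iff, eq_comm]

theorem imgPair_injective (k : ℕ) :
    Function.Injective (imgPair k).1 ∧ Function.Injective (imgPair k).2 := by
  induction k with
  | zero => exact ⟨Function.injective_id, Function.injective_id⟩
  | succ k ih =>
    constructor <;> intro v w <;> induction v using Fin.consCases with | _ x v => ?_ <;>
      induction w using Fin.consCases with | _ y w => ?_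
    · fin_cases x <;> fin_cases y <;> simp [imgPair, Fin.cons_inj, ih.2.eq_iff]
    · fin_cases x <;> fin_cases y <;> simp [imgPair, Fin.cons_inj, ih.1.eq_iff]

/-- Words of length `k + 1` split according to their first letter. -/
def wordSplit (k : ℕ) : (Fin k → Fin 2) ⊕ (Fin k → Fin 2) ≃ (Fin (k + 1) → Fin 2) :=
  ((Equiv.boolProdEquivSum _).symm.trans (finTwoEquiv.symm.prodCongr (Equiv.refl _))).trans
    (Fin.consEquiv fun _ => Fin 2)

@[simp]
theorem wordSplit_inl (k : ℕ) (v : Fin k → Fin 2) :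
    wordSplit k (Sum.inl v) = Fin.cons 0 v := rfl

@[simp]
theorem wordSplit_inr (k : ℕ) (v : Fin k → Fin 2) :
    wordSplit k (Sum.inr v) = Fin.cons 1 v := rfl

theorem permMat_imgPair_succ_fst (k : ℕ) :
    (permMat (imgPair (k + 1)).1).submatrix (wordSplit k) (wordSplit k) =
      fromBlocks 0 1 (permMat (imgPair k).2) 0 := by
  ext (i | i) (j | j) <;> simp [permMat, imgPair, one_apply, Fin.cons_inj, eq_comm]

theorem permMat_imgPair_succ_snd (k : ℕ) :
    (permMat (imgPair (k + 1)).2).submatrix (wordSplit k) (wordSplit k) =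
      fromBlocks (permMat (imgPair k).1) 0 0 1 := by
  ext (i | i) (j | j) <;> simp [permMat, imgPair, one_apply, Fin.cons_inj, eq_comm]

/-- The renormalization recursion for the spectral problem of `IMG(z²−1)`: with
`Λ = λ + 2λ₂`, `Φ_{k+1}(λ; λ₁, λ₂) = Φ_k(Λλ − 2λ₁²; Λλ₂, −λ₁²)`. -/
theorem img_z2_minus_1_det_recursion :
    ∀ (k : ℕ) (lam l1 l2 : ℝ),
      imgPhi (k + 1) lam l1 l2 =
        imgPhi k ((lam + 2 * l2) * lam - 2 * l1 ^ 2) ((lam + 2 * l2) * l2) (-(l1 ^ 2)) := by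
  intro k lam l1 l2
  set A := permMat (imgPair k).1 with hA
  set B := permMat (imgPair k).2 with hB
  have hBB : Bᵀ * B = 1 := permMat_transpose_mul_self (imgPair_injective k).2
  have hblock : (lam • (1 : Matrix (Fin (k + 1) → Fin 2) (Fin (k + 1) → Fin 2) ℝ) +
      l1 • (permMat (imgPair (k + 1)).1 + (permMat (imgPair (k + 1)).1)ᵀ) +
      l2 • (permMat (imgPair (k + 1)).2 + (permMat (imgPair (k + 1)).2)ᵀ)).submatrix
        (wordSplit k) (wordSplit k) =
      fromBlocks (lam • 1 + l2 • (A + Aᵀ)) (l1 • (1 + Bᵀ)) (l1 • (1 + B))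
        ((lam + 2 * l2) • (1 : Matrix (Fin k → Fin 2) (Fin k → Fin 2) ℝ)) := by
    simp only [submatrix_add, submatrix_smul, Pi.add_apply, Pi.smul_apply, ← transpose_submatrix,
      submatrix_one_equiv, permMat_imgPair_succ_fst, permMat_imgPair_succ_snd, ← hA, ← hB,
      fromBlocks_transpose, fromBlocks_add, fromBlocks_smul, ← fromBlocks_one, transpose_zero,
      transpose_one, add_zero, zero_add, smul_zero]
    congr 1
    · rw [add_comm B 1]
    · module
  unfold imgPhi
  rw [← det_submatrix_equiv_self (wordSplit k), hblock, det_fromBlocks_smul_one, ← hA, ← hB]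
  congr 1
  rw [smul_mul_smul_comm, add_mul, one_mul, mul_add, mul_one, hBB]
  module
end

section
/- The group IMG(z²−1) is torsion-free: every element of the group other than the identity has infinite order. -/
/-- Prepend a letter to an infinite binary sequence: `cns x w = xw`. -/
def cns (x : Bool) (w : ℕ → Bool) : ℕ → Bool :=
  fun n => match n with
  | 0 => x
  | k + 1 => w k

namespace Basilica

/-- The generators of the group and their inverses, as formal letters. -/
inductive Letter
  | a
  | aInv
  | b
  | bInv

open Letter

/-- The exponent of `a` in a letter. -/
def Letter.expA : Letter → ℤ
  | a => 1
  | aInv => -1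
  | _ => 0

/-- The exponent of `b` in a letter. -/
def Letter.expB : Letter → ℤ
  | b => 1
  | bInv => -1
  | _ => 0

/-- The first-level vertex to which a letter moves a given vertex. -/
def Letter.move : Letter → Bool → Bool
  | a, x => !x
  | aInv, x => !x
  | _, x => x

/-- The section of a letter at a first-level vertex, as a word of length at most one. -/
def Letter.localSection : Letter → Bool → List Letter
  | a, false => [b]
  | aInv, true => [bInv]
  | b, false => [a]
  | bInv, false => [aInv]
  | _, _ => []

/-- The exponent sum of `a` in a word. -/
def expA (w : List Letter) : ℤ := (w.map Letter.expA).sum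

/-- The exponent sum of `b` in a word. -/
def expB (w : List Letter) : ℤ := (w.map Letter.expB).sum

/-- The first-level vertex to which a word moves a given vertex; the head letter acts first. -/
def move : List Letter → Bool → Bool
  | [], x => x
  | l :: w, x => move w (l.move x)

/-- The section of a word at a first-level vertex. -/
def sectionAt : List Letter → Bool → List Letter
  | [], _ => []
  | l :: w, x => l.localSection x ++ sectionAt w (l.move x)

/-- The permutation represented by a letter. -/
def Letter.toPerm {α : Type*} (f g : Equiv.Perm α) : Letter → Equiv.Perm α
  | a => f
  | aInv => f⁻¹
  | b => g
  | bInv => g⁻¹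

/-- The permutation represented by a word; the head letter acts first. -/
def toPerm {α : Type*} (f g : Equiv.Perm α) : List Letter → Equiv.Perm α
  | [] => 1
  | l :: w => toPerm f g w * l.toPerm f g

theorem expA_append (v w : List Letter) : expA (v ++ w) = expA v + expA w := by
  simp [expA]

theorem expB_append (v w : List Letter) : expB (v ++ w) = expB v + expB w := by
  simp [expB]

theorem expA_cons (l : Letter) (w : List Letter) : expA (l :: w) = l.expA + expA w := by
  simp [expA]

theorem expB_cons (l : Letter) (w : List Letter) : expB (l :: w) = l.expB + expB w := by
  simp [expB]

theorem toPerm_append {α : Type*} (f g : Equiv.Perm α) (v w : List Letter) :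
    toPerm f g (v ++ w) = toPerm f g w * toPerm f g v := by
  induction v with
  | nil => simp [toPerm]
  | cons l v ih => simp [toPerm, ih, mul_assoc]

theorem Letter.move_not (l : Letter) (x : Bool) : l.move (!x) = !l.move x := by
  cases l <;> rfl

theorem length_sectionAt_add (w : List Letter) (x : Bool) :
    (sectionAt w x).length + (sectionAt w (!x)).length = w.length := by
  induction w generalizing x with
  | nil => rfl
  | cons l w ih =>
    have h := ih (l.move x)
    have hl : (l.localSection x).length + (l.localSection (!x)).length = 1 := by
      cases l <;> cases x <;> rfl
    simp only [sectionAt, List.length_append, List.length_cons, l.move_not]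
    omega

theorem expA_sectionAt_add (w : List Letter) (x : Bool) :
    expA (sectionAt w x) + expA (sectionAt w (!x)) = expB w := by
  induction w generalizing x with
  | nil => rfl
  | cons l w ih =>
    have h := ih (l.move x)
    have hl : expA (l.localSection x) + expA (l.localSection (!x)) = l.expB := by
      cases l <;> cases x <;> rfl
    simp only [sectionAt, expA_append, expB_cons, l.move_not]
    omega

theorem expB_sectionAt_add (w : List Letter) (x : Bool) :
    expB (sectionAt w x) + expB (sectionAt w (!x)) = expA w := by
  induction w generalizing x with
  | nil => rfl
  | cons l w ih =>
    have h := ih (l.move x)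
    have hl : expB (l.localSection x) + expB (l.localSection (!x)) = l.expA := by
      cases l <;> cases x <;> rfl
    simp only [sectionAt, expB_append, expA_cons, l.move_not]
    omega

theorem expA_eq_of_sectionAt_not_eq_nil (w : List Letter) (x : Bool)
    (h : sectionAt w (!x) = []) : expA w = (move w x).toInt - x.toInt := by
  induction w generalizing x with
  | nil => simp [expA, move]
  | cons l w ih =>
    rw [sectionAt, List.append_eq_nil_iff, l.move_not] at h
    have h' := ih _ h.2
    have hl : l.expA = (l.move x).toInt - x.toInt := by
      have := h.1
      cases l <;> cases x <;> first | rfl | simp [Letter.localSection] at this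
    rw [expA_cons, move, h', hl]
    ring

theorem move_eq_self_of_even (w : List Letter) (h : Even (expA w)) (x : Bool) :
    move w x = x := by
  have key : ∀ (w : List Letter) (x : Bool), move w x = x ↔ Even (expA w) := by
    intro w
    induction w with
    | nil => simp [move, expA]
    | cons l w ih =>
      intro x
      have hnot : ∀ y, move w (!y) = y ↔ ¬ Even (expA w) := by
        intro y
        rw [← ih (!y)]
        cases move w (!y) <;> cases y <;> simp
      rw [expA_cons, move, Int.even_add]
      cases l <;> simp [Letter.move, Letter.expA, ih, hnot]
  exact (key w x).2 h

theorem cns_injective (x : Bool) : Function.Injective (cns x) := fun _ _ h =>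
  funext fun n => congrFun h (n + 1)

theorem cns_head_tail (u : ℕ → Bool) : cns (u 0) (fun n => u (n + 1)) = u := by
  funext n
  cases n <;> rfl

/-- The recursions defining the two generators of the group. -/
structure IsGenerators (f g : Equiv.Perm (ℕ → Bool)) : Prop where
  left_false : ∀ w, f (cns false w) = cns true (g w)
  left_true : ∀ w, f (cns true w) = cns false w
  right_false : ∀ w, g (cns false w) = cns false (f w)
  right_true : ∀ w, g (cns true w) = cns true w

namespace IsGenerators

variable {f g : Equiv.Perm (ℕ → Bool)}

theorem letter_toPerm_cns (h : IsGenerators f g) (l : Letter) (x : Bool) (u : ℕ → Bool) :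
    l.toPerm f g (cns x u) = cns (l.move x) (toPerm f g (l.localSection x) u) := by
  cases l <;> cases x <;>
    simp [Letter.toPerm, Letter.move, Letter.localSection, toPerm, Equiv.symm_apply_eq,
      h.left_false, h.left_true, h.right_false, h.right_true]

theorem toPerm_cns (h : IsGenerators f g) (w : List Letter) (x : Bool) (u : ℕ → Bool) :
    toPerm f g w (cns x u) = cns (move w x) (toPerm f g (sectionAt w x) u) := by
  induction w generalizing x u with
  | nil => rfl
  | cons l w ih =>
    rw [toPerm, Equiv.Perm.mul_apply, h.letter_toPerm_cns, ih, sectionAt, toPerm_append, move,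
      Equiv.Perm.mul_apply]

theorem move_eq_self (h : IsGenerators f g) {w : List Letter} (hw : toPerm f g w = 1)
    (x : Bool) : move w x = x := by
  have := congrFun (h.toPerm_cns w x fun _ => x) 0
  rw [hw] at this
  exact this.symm

theorem toPerm_sectionAt_eq_one (h : IsGenerators f g) {w : List Letter}
    (hw : toPerm f g w = 1) (x : Bool) : toPerm f g (sectionAt w x) = 1 := by
  ext1 u
  have := h.toPerm_cns w x u
  rw [hw, h.move_eq_self hw] at this
  exact (cns_injective x this).symm

theorem expA_eq_zero_of_sectionAt_eq_nil (h : IsGenerators f g) {w : List Letter}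
    (hw : toPerm f g w = 1) {x : Bool} (hx : sectionAt w x = []) : expA w = 0 := by
  have := expA_eq_of_sectionAt_not_eq_nil w (!x) (by rwa [Bool.not_not])
  rwa [h.move_eq_self hw, sub_self] at this

/-- Both exponent sums of a relator vanish. -/
theorem exp_eq_zero (h : IsGenerators f g) (w : List Letter) (hw : toPerm f g w = 1) :
    expA w = 0 ∧ expB w = 0 := by
  induction hn : w.length using Nat.strong_induction_on generalizing w with
  | _ n ih =>
    have short : ∀ v : List Letter, v.length = n → toPerm f g v = 1 →
        (∀ x, sectionAt v x ≠ []) → expA v = 0 ∧ expB v = 0 := by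
      intro v hv hv1 hne
      have hlen := length_sectionAt_add v false
      have h0 := List.length_pos_iff.2 (hne false)
      have h1 := List.length_pos_iff.2 (hne true)
      rw [Bool.not_false] at hlen
      have i0 := ih (sectionAt v false).length (by omega) _
        (h.toPerm_sectionAt_eq_one hv1 false) rfl
      have i1 := ih (sectionAt v true).length (by omega) _
        (h.toPerm_sectionAt_eq_one hv1 true) rfl
      have eA := expA_sectionAt_add v false
      have eB := expB_sectionAt_add v false
      rw [Bool.not_false] at eA eB
      omega
    by_cases hne : ∀ x, sectionAt w x ≠ []
    · exact short w hn hw hne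
    push Not at hne
    obtain ⟨x, hx⟩ := hne
    have hA := h.expA_eq_zero_of_sectionAt_eq_nil hw hx
    refine ⟨hA, ?_⟩
    have hw' := h.toPerm_sectionAt_eq_one hw (!x)
    have hlen := length_sectionAt_add w x
    have eA := expA_sectionAt_add w x
    rw [hx] at hlen eA
    have hv : (sectionAt w (!x)).length = n := by simpa [hn] using hlen
    have hB : expB w = expA (sectionAt w (!x)) := by simpa [expA] using eA.symm
    rw [hB]
    by_cases hne' : ∀ y, sectionAt (sectionAt w (!x)) y ≠ []
    · exact (short _ hv hw' hne').1
    · push Not at hne'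
      obtain ⟨y, hy⟩ := hne'
      exact h.expA_eq_zero_of_sectionAt_eq_nil hw' hy

theorem expA_eq_zero_of_pow_eq_one (h : IsGenerators f g) (w : List Letter) {n : ℕ}
    (hn : 0 < n) (hw : toPerm f g w ^ n = 1) : expA w = 0 := by
  have key : ∀ m : ℕ, ∃ v, toPerm f g v = toPerm f g w ^ m ∧ expA v = m * expA w := by
    intro m
    induction m with
    | zero => exact ⟨[], by simp [toPerm], by simp [expA]⟩
    | succ m ih =>
      obtain ⟨v, hv, hvA⟩ := ih
      refine ⟨w ++ v, by rw [toPerm_append, hv, pow_succ], ?_⟩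
      rw [expA_append, hvA]
      push_cast
      ring
  obtain ⟨v, hv, hvA⟩ := key n
  have h0 := (h.exp_eq_zero v (hv.trans hw)).1
  rw [hvA] at h0
  exact (mul_eq_zero.1 h0).resolve_left (by exact_mod_cast hn.ne')

theorem toPerm_apply_eq_of_pow_eq_one (h : IsGenerators f g) (w : List Letter) {n : ℕ}
    (hn : 0 < n) (hw : toPerm f g w ^ n = 1) (u : ℕ → Bool) (k : ℕ) :
    toPerm f g w u k = u k := by
  induction k generalizing w u with
  | zero =>
    rw [← cns_head_tail u, h.toPerm_cns,
      move_eq_self_of_even w (by simp [h.expA_eq_zero_of_pow_eq_one w hn hw])]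
    rfl
  | succ k ih =>
    have hmove := move_eq_self_of_even w (by simp [h.expA_eq_zero_of_pow_eq_one w hn hw])
    have hpow : ∀ (m : ℕ) (x : Bool) (v : ℕ → Bool),
        (toPerm f g w ^ m) (cns x v) = cns x ((toPerm f g (sectionAt w x) ^ m) v) := by
      intro m x
      induction m with
      | zero => intro v; rfl
      | succ m ihm =>
        intro v
        rw [pow_succ, Equiv.Perm.mul_apply, h.toPerm_cns, hmove, ihm, pow_succ,
          Equiv.Perm.mul_apply]
    have hsec : ∀ x, toPerm f g (sectionAt w x) ^ n = 1 := by
      intro x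
      ext1 v
      have := hpow n x v
      rw [hw] at this
      exact (cns_injective x this).symm
    rw [← cns_head_tail u, h.toPerm_cns]
    exact ih _ (hsec _) _

end IsGenerators

theorem exists_toPerm_eq {α : Type*} {f g p : Equiv.Perm α}
    (hp : p ∈ Subgroup.closure ({f, g} : Set (Equiv.Perm α))) :
    ∃ w, toPerm f g w = p := by
  induction hp using Subgroup.closure_induction_right with
  | one => exact ⟨[], rfl⟩
  | mul_right p _ q hq ih =>
    obtain ⟨w, rfl⟩ := ih
    rcases hq with rfl | rfl
    · exact ⟨a :: w, rfl⟩
    · exact ⟨b :: w, rfl⟩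
  | mul_inv_cancel p _ q hq ih =>
    obtain ⟨w, rfl⟩ := ih
    rcases hq with rfl | rfl
    · exact ⟨aInv :: w, rfl⟩
    · exact ⟨bInv :: w, rfl⟩

end Basilica

/-- The iterated monodromy group `IMG(z²−1)` (generated by the bijections `a, b` of
`{0,1}^ω` with `a(0w) = 1·b(w)`, `a(1w) = 0w`, `b(0w) = 0·a(w)`, `b(1w) = 1w`) is
torsion-free: every non-identity element has infinite order. -/
theorem img_z2_minus_1_torsion_free
    (a b : Equiv.Perm (ℕ → Bool))
    (ha0 : ∀ w, a (cns false w) = cns true (b w))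
    (ha1 : ∀ w, a (cns true w) = cns false w)
    (hb0 : ∀ w, b (cns false w) = cns false (a w))
    (hb1 : ∀ w, b (cns true w) = cns true w) :
    ∀ g ∈ Subgroup.closure ({a, b} : Set (Equiv.Perm (ℕ → Bool))),
      g ≠ 1 → ∀ n : ℕ, 0 < n → g ^ n ≠ 1 := by
  intro p hp hne n hn hpn
  obtain ⟨w, rfl⟩ := Basilica.exists_toPerm_eq hp
  refine hne (Equiv.ext fun u => funext fun k => ?_)
  exact Basilica.IsGenerators.toPerm_apply_eq_of_pow_eq_one ⟨ha0, ha1, hb0, hb1⟩ w hn hpn u k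
end
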